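/- arXiv:1405.3909 — 11 statements merged into one kernel-verified Lean document; each statement's English description precedes it below -/
import Mathlib

section
/- Let R be a principal ideal domain and M ∈ Mat_m(R). If M = A·D·B = A'·D'·B' are two decompositions with A, B, A', B' ∈ GL_m(R), D = diag(d_1, …, d_m), D' = diag(d'_1, …, d'_m) diagonal with d_{i+1} | d_i and d'_{i+1} | d'_i for all i = 1, …, m−1, then for each i the elements d_i and d'_i are associates in R (they differ by multiplication by a unit). Consequently, two matrices M, N ∈ Mat_m(R) lie in the same GL_m(R)-double coset (N = U·M·V for some U, V ∈ GL_m(R)) if and only if their invariant factors are associates. -/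
theorem snf_antitone {R : Type*} [CommRing R] {m : ℕ} (d : Fin m → R)
    (hd : ∀ (i : ℕ) (hi : i + 1 < m), d ⟨i + 1, hi⟩ ∣ d ⟨i, Nat.lt_of_succ_lt hi⟩)
    (i j : Fin m) (hij : i ≤ j) : d j ∣ d i := by
  obtain ⟨i, hi⟩ := i
  obtain ⟨j, hj⟩ := j
  have hij' : i ≤ j := hij
  clear hij
  induction j, hij' using Nat.le_induction with
  | base => exact dvd_rfl
  | succ n hn ih => exact (hd n hj).trans (ih (Nat.lt_of_succ_lt hj))

theorem snf_dvd {R : Type*} [CommRing R] {m : ℕ} (d d' : Fin m → R)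
    (hd : ∀ i j : Fin m, i ≤ j → d j ∣ d i) (hd' : ∀ i j : Fin m, i ≤ j → d' j ∣ d' i)
    (P Q : Matrix (Fin m) (Fin m) R) (hQ : IsUnit Q)
    (h : Matrix.diagonal d * P = Q * Matrix.diagonal d') (k : Fin m) : d k ∣ d' k := by
  have h1 : ∀ i j : Fin m, i ≤ k → k ≤ j → d k ∣ Q i j * d' k := by
    intro i j hi hj
    have e := congrFun (congrFun h i) j
    rw [Matrix.diagonal_mul, Matrix.mul_diagonal] at e
    exact ((hd i k hi).trans (Dvd.intro _ e)).trans (mul_dvd_mul_left _ (hd' k j hj))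
  have h2 : d k ∣ Q.det * d' k := by
    rw [Matrix.det_apply', Finset.sum_mul]
    refine Finset.dvd_sum fun σ _ => ?_
    obtain ⟨j, hj, hs⟩ : ∃ j, k ≤ j ∧ σ j ≤ k := by
      by_contra! hc
      have hcard := Finset.card_le_card_of_injOn (s := Finset.Ici k) (t := Finset.Ioi k) σ
        (fun j hj => by simpa using hc j (by simpa using hj)) σ.injective.injOn
      simp only [Fin.card_Ici, Fin.card_Ioi] at hcard
      have := k.2
      omega
    rw [mul_assoc]
    refine Dvd.dvd.mul_left ?_ _
    exact (h1 _ _ hs hj).trans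
      (mul_dvd_mul_right (Finset.dvd_prod_of_mem (fun i => Q (σ i) i) (Finset.mem_univ j)) _)
  have hu : IsUnit Q.det := (Matrix.isUnit_iff_isUnit_det Q).1 hQ
  exact (hu.dvd_mul_left).1 h2

theorem snf_assoc {R : Type*} [CommRing R] [IsDomain R] {m : ℕ} (d d' : Fin m → R)
    (hd : ∀ (i : ℕ) (hi : i + 1 < m), d ⟨i + 1, hi⟩ ∣ d ⟨i, Nat.lt_of_succ_lt hi⟩)
    (hd' : ∀ (i : ℕ) (hi : i + 1 < m), d' ⟨i + 1, hi⟩ ∣ d' ⟨i, Nat.lt_of_succ_lt hi⟩)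
    (A B A' B' : (Matrix (Fin m) (Fin m) R)ˣ)
    (h : (A : Matrix (Fin m) (Fin m) R) * Matrix.diagonal d * B = A' * Matrix.diagonal d' * B')
    (i : Fin m) : Associated (d i) (d' i) := by
  have key : ∀ (d d' : Fin m → R) (A B A' B' : (Matrix (Fin m) (Fin m) R)ˣ),
      (A : Matrix (Fin m) (Fin m) R) * Matrix.diagonal d * B = A' * Matrix.diagonal d' * B' →
      Matrix.diagonal d * ((B * B'⁻¹ : (Matrix (Fin m) (Fin m) R)ˣ) : Matrix (Fin m) (Fin m) R)
        = ((A⁻¹ * A' : (Matrix (Fin m) (Fin m) R)ˣ) : Matrix (Fin m) (Fin m) R)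
          * Matrix.diagonal d' := by
    intro d d' A B A' B' h
    rw [Units.val_mul, Units.val_mul, ← mul_assoc, Units.mul_inv_eq_iff_eq_mul, mul_assoc,
      mul_assoc, Units.eq_inv_mul_iff_mul_eq, ← mul_assoc, ← mul_assoc, h]
  exact associated_of_dvd_dvd
    (snf_dvd d d' (snf_antitone d hd) (snf_antitone d' hd') _ _ (Units.isUnit _)
      (key _ _ _ _ _ _ h) i)
    (snf_dvd d' d (snf_antitone d' hd') (snf_antitone d hd) _ _ (Units.isUnit _)
      (key _ _ _ _ _ _ h.symm) i)

/-- **Smith Normal Form, uniqueness of invariant factors and classification of double cosets.**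
If `M = A * diagonal d * B = A' * diagonal d' * B'` are two Smith Normal Form decompositions
of the same matrix over a PID, then `d i` and `d' i` are associates for every `i`.
Consequently, given Smith Normal Forms of `M` and `N`, the matrices `M` and `N` lie in the
same `GL_m(R)`-double coset iff their invariant factors are associates. -/
theorem smith_normal_form_unique_and_double_cosets
    {R : Type*} [CommRing R] [IsDomain R] [IsPrincipalIdealRing R] {m : ℕ}
    (M N : Matrix (Fin m) (Fin m) R)
    (A B A' B' A'' B'' : (Matrix (Fin m) (Fin m) R)ˣ)
    (d d' e : Fin m → R)
    (hM : M = (A : Matrix (Fin m) (Fin m) R) * Matrix.diagonal d * B)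
    (hd : ∀ (i : ℕ) (hi : i + 1 < m), d ⟨i + 1, hi⟩ ∣ d ⟨i, Nat.lt_of_succ_lt hi⟩)
    (hM' : M = (A' : Matrix (Fin m) (Fin m) R) * Matrix.diagonal d' * B')
    (hd' : ∀ (i : ℕ) (hi : i + 1 < m), d' ⟨i + 1, hi⟩ ∣ d' ⟨i, Nat.lt_of_succ_lt hi⟩)
    (hN : N = (A'' : Matrix (Fin m) (Fin m) R) * Matrix.diagonal e * B'')
    (he : ∀ (i : ℕ) (hi : i + 1 < m), e ⟨i + 1, hi⟩ ∣ e ⟨i, Nat.lt_of_succ_lt hi⟩) :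
    (∀ i : Fin m, Associated (d i) (d' i)) ∧
    ((∃ U V : (Matrix (Fin m) (Fin m) R)ˣ,
        N = (U : Matrix (Fin m) (Fin m) R) * M * V) ↔
      ∀ i : Fin m, Associated (d i) (e i)) := by
  refine ⟨snf_assoc d d' hd hd' A B A' B' (hM ▸ hM'), ?_, ?_⟩
  · rintro ⟨U, V, hUV⟩
    refine snf_assoc d e hd he (U * A) (B * V) A'' B'' ?_
    rw [← hN, hUV, hM]
    simp only [Units.val_mul, mul_assoc]
  · intro h
    choose u hu using h
    let W : (Matrix (Fin m) (Fin m) R)ˣ :=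
      Units.map (Matrix.diagonalRingHom (Fin m) R).toMonoidHom (MulEquiv.piUnits.symm u)
    have hW : Matrix.diagonal d * (W : Matrix (Fin m) (Fin m) R) = Matrix.diagonal e := by
      have : (W : Matrix (Fin m) (Fin m) R) = Matrix.diagonal fun i => (u i : R) := rfl
      rw [this, Matrix.diagonal_mul_diagonal]
      congr 1
      funext i
      exact hu i
    refine ⟨A'' * A⁻¹, B⁻¹ * W * B'', ?_⟩
    rw [hN, hM, ← hW]
    simp only [Units.val_mul, mul_assoc, Units.inv_mul_cancel_left, Units.mul_inv_cancel_left]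
end

section
/- Let P(z) = I + P_1 z^{−1} + ⋯ + P_n z^{−n} with P_k ∈ Mat_m(ℂ) be a monic matrix polynomial in z^{−1}, and let A ∈ Mat_m(ℂ[z]) be any matrix polynomial in z. Then X_A(P) := (P·A)_+·P − P·(A·P)_+ is a matrix polynomial in z^{−1} with zero constant term and degree at most n in z^{−1}, i.e., X_A(P) ∈ z^{−1}Mat_m(ℂ[z^{−1}]) and all occurring powers of z^{−1} are between 1 and n. Moreover, if every entry of A is divisible by z^n, then X_A(P) = 0. -/
open LaurentPolynomial Polynomial

/-- The polynomial part (terms with nonnegative powers of `z`) of a Laurent polynomial,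
viewed again as a Laurent polynomial. -/
noncomputable def plusPart (p : LaurentPolynomial ℂ) : LaurentPolynomial ℂ :=
  Polynomial.toLaurent (LaurentPolynomial.trunc p)

/-- Coefficients vanish outside `s`. -/
def Sup (s : Set ℤ) (p : LaurentPolynomial ℂ) : Prop := ∀ k, k ∉ s → p.coeff k = 0

lemma Sup.mul {s t u : Set ℤ} {p q : LaurentPolynomial ℂ} (hp : Sup s p) (hq : Sup t q)
    (h : ∀ a ∈ s, ∀ b ∈ t, a + b ∈ u) : Sup u (p * q) := by
  intro k hk
  by_contra hne
  have h1 := AddMonoidAlgebra.support_coeff_mul_subset p q (Finsupp.mem_support_iff.mpr hne)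
  obtain ⟨a, ha, b, hb, hab⟩ := Finset.mem_add.mp h1
  apply hk
  rw [← hab]
  refine h a ?_ b ?_
  · by_contra h2
    exact Finsupp.mem_support_iff.mp ha (hp a h2)
  · by_contra h2
    exact Finsupp.mem_support_iff.mp hb (hq b h2)

lemma Sup.sub {s : Set ℤ} {p q : LaurentPolynomial ℂ} (hp : Sup s p) (hq : Sup s q) :
    Sup s (p - q) := by
  intro k hk
  simp [hp k hk, hq k hk]

lemma Sup.sum {ι : Type*} {s : Set ℤ} {f : ι → LaurentPolynomial ℂ} (t : Finset ι)
    (h : ∀ i ∈ t, Sup s (f i)) : Sup s (∑ i ∈ t, f i) := by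
  intro k hk
  rw [AddMonoidAlgebra.coeff_sum, Finsupp.finsetSum_apply]
  exact Finset.sum_eq_zero fun i hi => h i hi k hk

lemma coeff_T_mul_C (j k : ℤ) (c : ℂ) :
    (LaurentPolynomial.T j * LaurentPolynomial.C c : LaurentPolynomial ℂ).coeff k
      = if k = j then c else 0 := by
  rw [mul_comm, ← LaurentPolynomial.single_eq_C_mul_T, AddMonoidAlgebra.coeff_single,
    Finsupp.single_apply]
  simp only [eq_comm]

lemma plusPart_coeff (p : LaurentPolynomial ℂ) (k : ℤ) :
    (plusPart p).coeff k = if 0 ≤ k then p.coeff k else 0 := by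
  induction p using LaurentPolynomial.induction_on' with
  | add p q hp hq =>
    have : plusPart (p + q) = plusPart p + plusPart q := by simp [plusPart]
    rw [this, AddMonoidAlgebra.coeff_add, AddMonoidAlgebra.coeff_add, Finsupp.add_apply,
      Finsupp.add_apply, hp, hq]
    split_ifs <;> simp
  | C_mul_T j a =>
    rw [plusPart, LaurentPolynomial.trunc_C_mul_T]
    by_cases hj : 0 ≤ j
    · lift j to ℕ using hj
      rw [if_pos (by positivity), ← Polynomial.C_mul_X_pow_eq_monomial, Int.toNat_natCast,
        Polynomial.toLaurent_C_mul_X_pow, mul_comm, coeff_T_mul_C]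
      split_ifs <;> first | rfl | omega
    · rw [if_neg hj, mul_comm, coeff_T_mul_C, map_zero]
      simp only [AddMonoidAlgebra.coeff_zero, Finsupp.coe_zero, Pi.zero_apply]
      split_ifs <;> first | rfl | omega

lemma sup_plus (p : LaurentPolynomial ℂ) : Sup (Set.Ici 0) (plusPart p) := by
  intro k hk
  rw [plusPart_coeff, if_neg (by simpa using hk)]

lemma sup_minus (p : LaurentPolynomial ℂ) : Sup (Set.Iic (-1)) (p - plusPart p) := by
  intro k hk
  have : 0 ≤ k := by simp at hk; omega
  simp [plusPart_coeff, this]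

lemma plus_eq {p : LaurentPolynomial ℂ} (h : Sup (Set.Ici 0) p) : plusPart p = p := by
  apply LaurentPolynomial.ext
  intro k
  rw [plusPart_coeff]
  split_ifs with hk
  · rfl
  · exact (h k hk).symm

/-- Entrywise version. -/
def MSup {m : ℕ} (s : Set ℤ) (M : Matrix (Fin m) (Fin m) (LaurentPolynomial ℂ)) : Prop :=
  ∀ i j, Sup s (M i j)

lemma MSup.mul {m : ℕ} {s t u : Set ℤ} {M N : Matrix (Fin m) (Fin m) (LaurentPolynomial ℂ)}
    (hM : MSup s M) (hN : MSup t N) (h : ∀ a ∈ s, ∀ b ∈ t, a + b ∈ u) : MSup u (M * N) := by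
  intro i j
  rw [Matrix.mul_apply]
  exact Sup.sum _ fun l _ => (hM i l).mul (hN l j) h

lemma MSup.sub {m : ℕ} {s : Set ℤ} {M N : Matrix (Fin m) (Fin m) (LaurentPolynomial ℂ)}
    (hM : MSup s M) (hN : MSup s N) : MSup s (M - N) :=
  fun i j => (hM i j).sub (hN i j)

lemma toLaurent_sup (n : ℕ) (p : Polynomial ℂ) (h : (Polynomial.X : Polynomial ℂ) ^ n ∣ p) :
    Sup (Set.Ici (n : ℤ)) (Polynomial.toLaurent p) := by
  obtain ⟨q, rfl⟩ := h
  rw [map_mul, Polynomial.toLaurent_X_pow]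
  refine Sup.mul (s := Set.Ici (n : ℤ)) (t := Set.Ici 0) ?_ ?_ ?_
  · intro k hk
    rw [LaurentPolynomial.T_apply, if_neg]
    rintro rfl
    simp at hk
  · have := sup_plus (Polynomial.toLaurent q)
    rwa [plusPart, Polynomial.trunc_toLaurent] at this
  · intro a ha b hb
    simp at *
    omega

/-- **Structure of the dressing vector field `X_A(P)`.** For a monic matrix polynomial
`P(z) = I + P₁ z⁻¹ + ⋯ + Pₙ z⁻ⁿ` in `z⁻¹` and any matrix polynomial `A` in `z`, the
matrix Laurent polynomial `X_A(P) = (P·A)₊·P − P·(A·P)₊` is a matrix polynomial in `z⁻¹`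
with zero constant term and degree at most `n` (i.e. only powers `z⁻ˢ` with `1 ≤ s ≤ n`
occur). Moreover, if every entry of `A` is divisible by `zⁿ`, then `X_A(P) = 0`. -/
theorem dressing_field_structure
    (m n : ℕ) (Pc : ℕ → Matrix (Fin m) (Fin m) ℂ) (hP0 : Pc 0 = 1)
    (P : Matrix (Fin m) (Fin m) (LaurentPolynomial ℂ))
    (hP : P = ∑ k ∈ Finset.range (n + 1),
      (LaurentPolynomial.T (-(k : ℤ)) : LaurentPolynomial ℂ) • (Pc k).map LaurentPolynomial.C)
    (A : Matrix (Fin m) (Fin m) (Polynomial ℂ)) :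
    (∃ Xc : ℕ → Matrix (Fin m) (Fin m) ℂ,
      ((P * A.map Polynomial.toLaurent).map plusPart) * P
          - P * ((A.map Polynomial.toLaurent * P).map plusPart)
        = ∑ s ∈ Finset.Icc 1 n,
            (LaurentPolynomial.T (-(s : ℤ)) : LaurentPolynomial ℂ) •
              (Xc s).map LaurentPolynomial.C) ∧
    ((∀ i j, (Polynomial.X : Polynomial ℂ) ^ n ∣ A i j) →
      ((P * A.map Polynomial.toLaurent).map plusPart) * P
          - P * ((A.map Polynomial.toLaurent * P).map plusPart) = 0) := by
  have hPs : MSup (Set.Icc (-(n : ℤ)) 0) P := by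
    intro i j
    rw [hP, Matrix.sum_apply]
    refine Sup.sum _ fun l hl k hk => ?_
    rw [Matrix.smul_apply, Matrix.map_apply, smul_eq_mul, coeff_T_mul_C, if_neg]
    rintro rfl
    simp at hk hl
    omega
  set L := A.map Polynomial.toLaurent with hL
  have hplus : ∀ M : Matrix (Fin m) (Fin m) (LaurentPolynomial ℂ),
      MSup (Set.Ici 0) (M.map plusPart) := fun M i j => sup_plus _
  have hminus : ∀ M : Matrix (Fin m) (Fin m) (LaurentPolynomial ℂ),
      MSup (Set.Iic (-1)) (M - M.map plusPart) := fun M i j => sup_minus _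
  refine ⟨?_, ?_⟩
  · set Y := ((P * L).map plusPart) * P - P * ((L * P).map plusPart) with hY
    have h1 : MSup (Set.Ici (-(n : ℤ))) Y := by
      refine MSup.sub ((hplus _).mul hPs ?_) (hPs.mul (hplus _) ?_)
      all_goals
        intro a ha b hb
        simp at *
        omega
    have h2 : MSup (Set.Iic (-1)) Y := by
      have e : Y = P * (L * P - (L * P).map plusPart) - (P * L - (P * L).map plusPart) * P := by
        rw [hY, mul_sub, sub_mul, mul_assoc]
        abel
      rw [e]
      refine MSup.sub (hPs.mul (hminus _) ?_) ((hminus _).mul hPs ?_)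
      all_goals
        intro a ha b hb
        simp at *
        omega
    refine ⟨fun s => Matrix.of fun i j => (Y i j).coeff (-(s : ℤ)), ?_⟩
    refine Matrix.ext fun i j => ?_
    apply LaurentPolynomial.ext
    intro k
    rw [Matrix.sum_apply, AddMonoidAlgebra.coeff_sum, Finsupp.finsetSum_apply]
    simp only [Matrix.smul_apply, Matrix.map_apply, smul_eq_mul, coeff_T_mul_C, Matrix.of_apply]
    by_cases hk : k ∈ Set.Icc (-(n : ℤ)) (-1)
    · obtain ⟨hk1, hk2⟩ := hk
      rw [Finset.sum_eq_single (-k).toNat]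
      · have : -((-k).toNat : ℤ) = k := by omega
        rw [this, if_pos rfl]
      · intro b _ hb
        rw [if_neg]
        omega
      · intro hb
        exfalso
        apply hb
        rw [Finset.mem_Icc]
        omega
    · rw [Finset.sum_eq_zero]
      · by_cases hk1 : -(n : ℤ) ≤ k
        · exact h2 i j k fun h => hk ⟨hk1, h⟩
        · exact h1 i j k hk1
      · intro b hb
        rw [if_neg]
        rintro rfl
        rw [Finset.mem_Icc] at hb
        apply hk
        constructor <;> omega
  · intro hA
    have hLs : MSup (Set.Ici (n : ℤ)) L := fun i j => toLaurent_sup n _ (hA i j)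
    have e1 : (P * L).map plusPart = P * L := by
      refine Matrix.ext fun i j => plus_eq (MSup.mul hPs hLs ?_ i j)
      intro a ha b hb
      simp at *
      omega
    have e2 : (L * P).map plusPart = L * P := by
      refine Matrix.ext fun i j => plus_eq (MSup.mul hLs hPs ?_ i j)
      intro a ha b hb
      simp at *
      omega
    rw [e1, e2, mul_assoc, sub_self]
end

section
/- Let P(z) = I + P_1 z^{−1} + ⋯ + P_n z^{−n} with P_k ∈ Mat_m(ℂ) be a monic matrix polynomial in z^{−1}. Let B, C ∈ Mat_m(ℂ[z]) be matrix polynomials in z with entries of degree at most n−1 such that B(z)P(z) − P(z)C(z) has only strictly negative powers of z (i.e., (BP − PC)_+ = 0). Let A ∈ Mat_m(ℂ[z]) be the unique matrix polynomial of degree at most n−1 with (P·A)_+ = B. Then C = (A·P)_+, and consequently B·P − P·C = (P·A)_+·P − P·(A·P)_+. -/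
open LaurentPolynomial Polynomial

theorem aux_coeff_trunc (p : LaurentPolynomial ℂ) (k : ℕ) :
    (LaurentPolynomial.trunc p).coeff k = AddMonoidAlgebra.coeff p (k : ℤ) := rfl

/-- Laurent polynomials with only powers below `s`. -/
def lowPart (s : ℤ) : AddSubgroup (LaurentPolynomial ℂ) where
  carrier := {p | ∀ k : ℤ, s ≤ k → AddMonoidAlgebra.coeff p k = 0}
  zero_mem' := by intro k _; simp
  add_mem' := by
    intro a b ha hb k hk
    simp [ha k hk, hb k hk]
  neg_mem' := by
    intro a ha k hk
    simp [ha k hk]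

theorem mem_lowPart (s : ℤ) (p : LaurentPolynomial ℂ) :
    p ∈ lowPart s ↔ ∀ k : ℤ, s ≤ k → AddMonoidAlgebra.coeff p k = 0 := Iff.rfl

theorem lowPart_mono {s t : ℤ} (h : s ≤ t) {p : LaurentPolynomial ℂ} (hp : p ∈ lowPart s) :
    p ∈ lowPart t := fun k hk => hp k (h.trans hk)

theorem mul_mem_lowPart {s t r : ℤ} (h : s + t - 1 ≤ r) {p q : LaurentPolynomial ℂ}
    (hp : p ∈ lowPart s) (hq : q ∈ lowPart t) : p * q ∈ lowPart r := by
  intro k hk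
  rw [AddMonoidAlgebra.coeff_mul]
  refine Finset.sum_eq_zero fun a _ => Finset.sum_eq_zero fun b _ => ?_
  dsimp only
  split_ifs with hab
  · by_cases ha : s ≤ a
    · rw [hp a ha, zero_mul]
    · rw [hq b (by omega), mul_zero]
  · rfl

theorem mem_lowPart_zero (p : LaurentPolynomial ℂ) :
    p ∈ lowPart 0 ↔ LaurentPolynomial.trunc p = 0 := by
  constructor
  · intro h
    ext k
    rw [aux_coeff_trunc, h k (by omega)]; simp
  · intro h k hk
    lift k to ℕ using hk
    rw [← aux_coeff_trunc, h]; simp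

theorem exists_lowPart (p : LaurentPolynomial ℂ) : ∃ s : ℕ, p ∈ lowPart s := by
  obtain ⟨M, hM⟩ := (AddMonoidAlgebra.coeff p).support.bddAbove
  refine ⟨(M + 1).toNat, fun k hk => ?_⟩
  by_contra hne
  have := hM (Finsupp.mem_support_iff.mpr hne)
  omega

theorem mat_mul_low {m : ℕ} {s t r : ℤ} (h : s + t - 1 ≤ r)
    {M N : Matrix (Fin m) (Fin m) (LaurentPolynomial ℂ)}
    (hM : ∀ i j, M i j ∈ lowPart s) (hN : ∀ i j, N i j ∈ lowPart t) (i j) :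
    (M * N) i j ∈ lowPart r := by
  rw [Matrix.mul_apply]
  exact sum_mem fun l _ => mul_mem_lowPart h (hM _ _) (hN _ _)

theorem mat_descend {m : ℕ} (Q D : Matrix (Fin m) (Fin m) (LaurentPolynomial ℂ))
    (hQ : ∀ i j, Q i j ∈ lowPart 0) (hPD : ∀ i j, ((1 + Q) * D) i j ∈ lowPart 0)
    (s : ℕ) (hD : ∀ i j, D i j ∈ lowPart s) : ∀ i j, D i j ∈ lowPart 0 := by
  induction s with
  | zero => simpa using hD
  | succ s ih =>
    apply ih
    intro i j
    have e : D = (1 + Q) * D - Q * D := by noncomm_ring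
    rw [e, Matrix.sub_apply]
    refine sub_mem (lowPart_mono (by omega) (hPD i j)) ?_
    exact mat_mul_low (by push_cast; omega) hQ hD i j

theorem P_low {m : ℕ} (n : ℕ) (Pc : ℕ → Matrix (Fin m) (Fin m) ℂ) (hP0 : Pc 0 = 1) :
    ∃ Q : Matrix (Fin m) (Fin m) (LaurentPolynomial ℂ), (∀ i j, Q i j ∈ lowPart 0) ∧
    ∑ k ∈ Finset.range (n + 1),
      (LaurentPolynomial.T (-(k : ℤ)) : LaurentPolynomial ℂ) • (Pc k).map LaurentPolynomial.C
      = 1 + Q := by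
  refine ⟨_, ?_, by
    rw [Finset.sum_range_succ', add_comm, hP0]
    congr 1
    simp⟩
  intro i j
  rw [Matrix.sum_apply]
  refine sum_mem fun k _ => ?_
  rw [Matrix.smul_apply, Matrix.map_apply, smul_eq_mul, mul_comm,
    ← LaurentPolynomial.single_eq_C_mul_T]
  intro l hl
  rw [AddMonoidAlgebra.coeff_single, Finsupp.single_eq_of_ne]
  push_cast
  omega

/-- **Tangent vectors to double cosets are dressing vectors.** Let
`P(z) = I + P₁ z⁻¹ + ⋯ + Pₙ z⁻ⁿ` be a monic matrix polynomial in `z⁻¹`, and let `B, C`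
be matrix polynomials in `z` with entries of degree `< n` such that `B·P − P·C` has only
strictly negative powers of `z`, i.e. `(B·P − P·C)₊ = 0`. If `A` is the (unique) matrix
polynomial in `z` of degree `< n` with `(P·A)₊ = B`, then `C = (A·P)₊`, and consequently
`B·P − P·C = (P·A)₊·P − P·(A·P)₊`. -/
theorem cosets_tangent_eq_dressing
    (m n : ℕ) (Pc : ℕ → Matrix (Fin m) (Fin m) ℂ) (hP0 : Pc 0 = 1)
    (P : Matrix (Fin m) (Fin m) (LaurentPolynomial ℂ))
    (hP : P = ∑ k ∈ Finset.range (n + 1),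
      (LaurentPolynomial.T (-(k : ℤ)) : LaurentPolynomial ℂ) • (Pc k).map LaurentPolynomial.C)
    (B C : Matrix (Fin m) (Fin m) (Polynomial ℂ))
    (hB : ∀ i j, (B i j).degree < (n : ℕ)) (hC : ∀ i j, (C i j).degree < (n : ℕ))
    (hBC : (B.map Polynomial.toLaurent * P - P * C.map Polynomial.toLaurent).map
      (fun p => LaurentPolynomial.trunc p) = 0)
    (A : Matrix (Fin m) (Fin m) (Polynomial ℂ))
    (hA : ∀ i j, (A i j).degree < (n : ℕ))
    (hPA : (P * A.map Polynomial.toLaurent).map (fun p => LaurentPolynomial.trunc p) = B) :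
    C = (A.map Polynomial.toLaurent * P).map (fun p => LaurentPolynomial.trunc p) ∧
    B.map Polynomial.toLaurent * P - P * C.map Polynomial.toLaurent
      = ((P * A.map Polynomial.toLaurent).map plusPart) * P
          - P * ((A.map Polynomial.toLaurent * P).map plusPart) := by
  have key : C = (A.map Polynomial.toLaurent * P).map
      (fun p => LaurentPolynomial.trunc p) := by
    obtain ⟨Q, hQ, hPQ⟩ := P_low n Pc hP0
    rw [hPQ] at hP
    set A' := A.map Polynomial.toLaurent with hA'
    set B' := B.map Polynomial.toLaurent with hB'
    set C' := C.map Polynomial.toLaurent with hC'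
    have hone : ∀ i j, (1 : Matrix (Fin m) (Fin m) (LaurentPolynomial ℂ)) i j ∈ lowPart 1 := by
      intro i j
      rw [Matrix.one_apply]
      split_ifs
      · intro k hk
        rw [AddMonoidAlgebra.one_def, AddMonoidAlgebra.coeff_single, Finsupp.single_eq_of_ne]
        omega
      · exact zero_mem _
    have hPl : ∀ i j, P i j ∈ lowPart 1 := by
      intro i j
      rw [hP, Matrix.add_apply]
      exact add_mem (hone i j) (lowPart_mono (by omega) (hQ i j))
    have hN : ∀ i j, (P * A' - B') i j ∈ lowPart 0 := by
      intro i j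
      rw [mem_lowPart_zero, Matrix.sub_apply, map_sub, hB', Matrix.map_apply,
        Polynomial.trunc_toLaurent, ← congrFun (congrFun hPA i) j, Matrix.map_apply, sub_self]
    have hBC' : ∀ i j, (B' * P - P * C') i j ∈ lowPart 0 := by
      intro i j
      rw [mem_lowPart_zero]
      exact congrFun (congrFun hBC i) j
    have hPD : ∀ i j, ((1 + Q) * (A' * P - C')) i j ∈ lowPart 0 := by
      intro i j
      have e : (1 + Q) * (A' * P - C') = (B' * P - P * C') + (P * A' - B') * P := by
        rw [← hP]; noncomm_ring
      rw [e, Matrix.add_apply]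
      exact add_mem (hBC' i j) (mat_mul_low (by norm_num) hN hPl i j)
    choose f hf using fun i j => exists_lowPart ((A' * P - C') i j)
    have hD := mat_descend Q (A' * P - C') hQ hPD (∑ i, ∑ j, f i j) (fun i j =>
      lowPart_mono (Nat.cast_le.mpr ((Finset.single_le_sum (f := fun j => f i j)
        (fun _ _ => Nat.zero_le _) (Finset.mem_univ j)).trans
        (Finset.single_le_sum (f := fun i => ∑ j, f i j)
        (fun _ _ => Nat.zero_le _) (Finset.mem_univ i)))) (hf i j))
    ext1 i j
    have := hD i j
    rw [mem_lowPart_zero, Matrix.sub_apply, map_sub, hC', Matrix.map_apply,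
      Polynomial.trunc_toLaurent, sub_eq_zero] at this
    rw [Matrix.map_apply, this]
  refine ⟨key, ?_⟩
  have h1 : (P * A.map Polynomial.toLaurent).map plusPart = B.map Polynomial.toLaurent := by
    rw [← hPA]; rfl
  have h2 : (A.map Polynomial.toLaurent * P).map plusPart = C.map Polynomial.toLaurent := by
    rw [key]; rfl
  rw [h1, h2]
end

section
/- Let P(z) = z^n I + P_1 z^{n−1} + ⋯ + P_n, P_k ∈ Mat_m(ℂ), be a monic m×m matrix polynomial of degree n. Let λ_1, …, λ_m ∈ ℂ and let v_1, …, v_m ∈ ℂ^m be linearly independent vectors with P(λ_i)v_i = 0 for i = 1, …, m. Let A ∈ Mat_m(ℂ) be the unique matrix determined by A v_i = λ_i v_i for i = 1, …, m. Then zI − A is a right divisor of P(z): there exists a monic matrix polynomial Q(z) of degree n−1 with P(z) = Q(z)·(zI − A). -/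
open Polynomial

def rdQ {m : ℕ} (Pc : ℕ → Matrix (Fin m) (Fin m) ℂ) (A : Matrix (Fin m) (Fin m) ℂ) :
    ℕ → Matrix (Fin m) (Fin m) ℂ
  | 0 => Pc 0
  | k + 1 => rdQ Pc A k * A + Pc (k + 1)

theorem rd_shift {m : ℕ} (F : ℕ → Matrix (Fin m) (Fin m) ℂ) (n : ℕ) :
    ∑ k ∈ Finset.range (n + 1), ((X : ℂ[X]) ^ (n - k)) • (F k).map C
      = (X : ℂ[X]) • (∑ k ∈ Finset.range n, ((X : ℂ[X]) ^ (n - 1 - k)) • (F k).map C)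
        + (F n).map C := by
  rw [Finset.sum_range_succ, Finset.smul_sum]
  congr 1
  · apply Finset.sum_congr rfl
    intro k hk
    have hk' := Finset.mem_range.1 hk
    rw [smul_smul, ← pow_succ']
    congr 2
    omega
  · simp

theorem rd_div {m : ℕ} (Pc : ℕ → Matrix (Fin m) (Fin m) ℂ) (A : Matrix (Fin m) (Fin m) ℂ)
    (n : ℕ) :
    ∑ k ∈ Finset.range (n + 1), ((X : ℂ[X]) ^ (n - k)) • (Pc k).map C
      = (∑ k ∈ Finset.range n, ((X : ℂ[X]) ^ (n - 1 - k)) • (rdQ Pc A k).map C) *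
          ((X : ℂ[X]) • (1 : Matrix (Fin m) (Fin m) ℂ[X]) - A.map C)
        + (rdQ Pc A n).map C := by
  induction n with
  | zero => simp [rdQ]
  | succ n ih =>
    rw [rd_shift Pc (n + 1)]
    simp only [Nat.add_sub_cancel]
    rw [ih, rd_shift (rdQ Pc A) n]
    have h : (rdQ Pc A (n + 1)).map (C : ℂ →+* ℂ[X])
        = (rdQ Pc A n).map C * A.map C + (Pc (n + 1)).map C := by
      rw [← Matrix.map_mul, ← Matrix.map_add _ (map_add _)]
      rfl
    rw [h]
    simp only [add_mul, mul_sub, smul_add, smul_sub, Matrix.smul_mul, Matrix.mul_smul, mul_one]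
    abel

/-- **Right divisors from eigenvectors.** Let `P(z) = zⁿI + P₁zⁿ⁻¹ + ⋯ + Pₙ` be a monic
matrix polynomial, let `λ₁, …, λ_m ∈ ℂ`, and let `v₁, …, v_m` be linearly independent
vectors with `P(λᵢ)vᵢ = 0`. If `A` is the matrix determined by `A vᵢ = λᵢ vᵢ`, then
`zI − A` is a right divisor of `P(z)`: there is a monic matrix polynomial `Q(z)` of degree
`n − 1` with `P(z) = Q(z)·(zI − A)`. -/
theorem right_divisor_of_eigenvectors
    (m n : ℕ) (Pc : ℕ → Matrix (Fin m) (Fin m) ℂ) (hP0 : Pc 0 = 1)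
    (P : Matrix (Fin m) (Fin m) (Polynomial ℂ))
    (hP : P = ∑ k ∈ Finset.range (n + 1),
      ((Polynomial.X : Polynomial ℂ) ^ (n - k)) • (Pc k).map Polynomial.C)
    (lam : Fin m → ℂ) (v : Fin m → (Fin m → ℂ))
    (hv : LinearIndependent ℂ v)
    (hPv : ∀ i, (P.map (Polynomial.eval (lam i))).mulVec (v i) = 0)
    (A : Matrix (Fin m) (Fin m) ℂ)
    (hA : ∀ i, A.mulVec (v i) = lam i • v i) :
    ∃ Qc : ℕ → Matrix (Fin m) (Fin m) ℂ, Qc 0 = 1 ∧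
      P = (∑ k ∈ Finset.range n,
            ((Polynomial.X : Polynomial ℂ) ^ (n - 1 - k)) • (Qc k).map Polynomial.C) *
          ((Polynomial.X : Polynomial ℂ) • (1 : Matrix (Fin m) (Fin m) (Polynomial ℂ))
            - A.map Polynomial.C) := by
  refine ⟨rdQ Pc A, hP0, ?_⟩
  have key := rd_div Pc A n
  rw [← hP] at key
  have hz : ∀ i, (rdQ Pc A n).mulVec (v i) = 0 := by
    intro i
    have h := hPv i
    have e : P.map (Polynomial.eval (lam i)) = (evalRingHom (lam i)).mapMatrix P := rfl
    have eC : ∀ B : Matrix (Fin m) (Fin m) ℂ,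
        (evalRingHom (lam i)).mapMatrix (B.map C) = B := by
      intro B; ext a b; simp
    have eX : (evalRingHom (lam i)).mapMatrix
        ((X : ℂ[X]) • (1 : Matrix (Fin m) (Fin m) ℂ[X])) = lam i • 1 := by
      ext a b
      by_cases hab : a = b <;> simp [Matrix.one_apply, hab]
    rw [e, key, map_add, map_mul, map_sub, eC, eC, eX, Matrix.add_mulVec,
      ← Matrix.mulVec_mulVec, Matrix.sub_mulVec, Matrix.smul_mulVec, Matrix.one_mulVec, hA,
      sub_self, Matrix.mulVec_zero, zero_add] at h
    exact h
  have hQ : rdQ Pc A n = 0 := by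
    have hs := hv.span_eq_top_of_card_eq_finrank' (by simp)
    have : Matrix.toLin' (rdQ Pc A n) = 0 := by
      apply LinearMap.ext_on_range hs
      intro i
      simpa using hz i
    simpa using this
  rw [hQ] at key
  simpa using key
end

section
/- Let P(z) = z^n I + P_1 z^{n−1} + ⋯ + P_n, P_k ∈ Mat_m(ℂ), be a monic m×m matrix polynomial of degree n whose determinant det P(z) (a monic complex polynomial of degree mn) has mn pairwise distinct roots. Let Λ ⊆ ℂ be a set of m of these roots. Then there is at most one matrix A ∈ Mat_m(ℂ) such that zI − A is a right divisor of P(z) and the set of eigenvalues of A equals Λ. -/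
open Polynomial

theorem aux_kernel {m : ℕ} (P Q Q' : Matrix (Fin m) (Fin m) (Polynomial ℂ))
    (A A' : Matrix (Fin m) (Fin m) ℂ) (hsq : Squarefree P.det)
    (h : P = Q * ((Polynomial.X : Polynomial ℂ) • (1 : Matrix (Fin m) (Fin m) (Polynomial ℂ))
            - A.map Polynomial.C))
    (h' : P = Q' * ((Polynomial.X : Polynomial ℂ) • (1 : Matrix (Fin m) (Fin m) (Polynomial ℂ))
            - A'.map Polynomial.C))
    (μ : ℂ) (hμ : μ ∈ spectrum ℂ A) (v : Fin m → ℂ) (hv : A'.mulVec v = μ • v) :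
    A.mulVec v = μ • v := by
  have hev : ∀ B : Matrix (Fin m) (Fin m) ℂ, (evalRingHom μ).mapMatrix
      ((Polynomial.X : Polynomial ℂ) • (1 : Matrix (Fin m) (Fin m) (Polynomial ℂ))
            - B.map Polynomial.C) = μ • (1 : Matrix (Fin m) (Fin m) ℂ) - B := by
    intro B
    ext i j
    by_cases hij : i = j <;> simp [hij, Matrix.one_apply]
  have hQ : ((evalRingHom μ).mapMatrix Q).det ≠ 0 := by
    intro h0
    rw [← RingHom.map_det, coe_evalRingHom] at h0
    have d1 : X - C μ ∣ Q.det := dvd_iff_isRoot.mpr h0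
    have d2 : X - C μ ∣ ((Polynomial.X : Polynomial ℂ) •
        (1 : Matrix (Fin m) (Fin m) (Polynomial ℂ)) - A.map Polynomial.C).det := by
      refine dvd_iff_isRoot.mpr ?_
      rw [IsRoot.def, ← coe_evalRingHom, RingHom.map_det, hev]
      rw [spectrum.mem_iff, Matrix.isUnit_iff_isUnit_det, isUnit_iff_ne_zero, not_not,
        Algebra.algebraMap_eq_smul_one] at hμ
      exact hμ
    have d := mul_dvd_mul d1 d2
    rw [← Matrix.det_mul, ← h] at d
    exact (Polynomial.not_isUnit_X_sub_C μ) (hsq _ d)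
  have e := congrArg (evalRingHom μ).mapMatrix (h.symm.trans h')
  rw [map_mul, map_mul, hev, hev] at e
  have e2 := congrArg (fun M => M.mulVec v) e
  simp only [← Matrix.mulVec_mulVec, Matrix.sub_mulVec, Matrix.smul_mulVec, Matrix.one_mulVec,
    hv, sub_self, Matrix.mulVec_zero] at e2
  have := Matrix.eq_zero_of_mulVec_eq_zero hQ e2
  exact (sub_eq_zero.mp this).symm

/-- **Uniqueness of right divisors with prescribed spectrum.** Let
`P(z) = zⁿI + P₁zⁿ⁻¹ + ⋯ + Pₙ` be a monic matrix polynomial whose determinant has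
`m·n` pairwise distinct roots `ρ₁, …, ρ_{mn}`, and let `Λ` be a set of `m` of these
roots. Then there is at most one matrix `A` such that `zI − A` is a right divisor of
`P(z)` and the set of eigenvalues of `A` equals `Λ`. -/
theorem right_divisor_unique_of_spectrum
    (m n : ℕ) (Pc : ℕ → Matrix (Fin m) (Fin m) ℂ) (hP0 : Pc 0 = 1)
    (P : Matrix (Fin m) (Fin m) (Polynomial ℂ))
    (hP : P = ∑ k ∈ Finset.range (n + 1),
      ((Polynomial.X : Polynomial ℂ) ^ (n - k)) • (Pc k).map Polynomial.C)
    (ρ : Fin (m * n) → ℂ) (hρ : Function.Injective ρ)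
    (hdet : P.det = ∏ i, (Polynomial.X - Polynomial.C (ρ i)))
    (Λ : Finset ℂ) (hΛcard : Λ.card = m) (hΛ : (Λ : Set ℂ) ⊆ Set.range ρ)
    (A A' : Matrix (Fin m) (Fin m) ℂ)
    (hAdiv : ∃ Qc : ℕ → Matrix (Fin m) (Fin m) ℂ, Qc 0 = 1 ∧
      P = (∑ k ∈ Finset.range n,
            ((Polynomial.X : Polynomial ℂ) ^ (n - 1 - k)) • (Qc k).map Polynomial.C) *
          ((Polynomial.X : Polynomial ℂ) • (1 : Matrix (Fin m) (Fin m) (Polynomial ℂ))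
            - A.map Polynomial.C))
    (hAspec : spectrum ℂ A = ↑Λ)
    (hA'div : ∃ Qc : ℕ → Matrix (Fin m) (Fin m) ℂ, Qc 0 = 1 ∧
      P = (∑ k ∈ Finset.range n,
            ((Polynomial.X : Polynomial ℂ) ^ (n - 1 - k)) • (Qc k).map Polynomial.C) *
          ((Polynomial.X : Polynomial ℂ) • (1 : Matrix (Fin m) (Fin m) (Polynomial ℂ))
            - A'.map Polynomial.C))
    (hA'spec : spectrum ℂ A' = ↑Λ) :
    A = A' := by
  obtain ⟨Qc, -, hQ⟩ := hAdiv
  obtain ⟨Qc', -, hQ'⟩ := hA'div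
  have hsq : Squarefree P.det := by
    rw [hdet]
    exact (separable_prod_X_sub_C_iff.mpr hρ).squarefree
  have hex : ∀ μ : Λ, ∃ v, Module.End.HasEigenvector (Matrix.toLin' A') (μ : ℂ) v := by
    intro μ
    apply Module.End.HasEigenvalue.exists_hasEigenvector
    rw [Module.End.hasEigenvalue_iff_mem_spectrum, Matrix.spectrum_toLin', hA'spec]
    exact μ.2
  choose v hv using hex
  have hli : LinearIndependent ℂ v :=
    Module.End.eigenvectors_linearIndependent' (Matrix.toLin' A') (fun μ : Λ => (μ : ℂ))
      Subtype.val_injective v hv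
  have hspan := hli.span_eq_top_of_card_eq_finrank' (by simp [hΛcard])
  apply Matrix.toLin'.injective
  apply LinearMap.ext_on_range hspan
  intro μ
  have h1 := (hv μ).apply_eq_smul
  rw [h1, Matrix.toLin'_apply]
  rw [Matrix.toLin'_apply] at h1
  exact aux_kernel P _ _ A A' hsq hQ hQ' μ (by rw [hAspec]; exact μ.2) _ h1
end

section
/- Let P(z) = z^n I + P_1 z^{n−1} + ⋯ + P_n, P_k ∈ Mat_m(ℂ), be a monic m×m matrix polynomial of degree n whose determinant det P(z) has mn pairwise distinct roots. Then P(z) admits a decomposition into linear factors: there exist matrices A_1, …, A_n ∈ Mat_m(ℂ) such that P(z) = (zI − A_1)·(zI − A_2)·⋯·(zI − A_n). -/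
open Polynomial

noncomputable def fvEv (m : ℕ) (z : ℂ) :
    (Matrix (Fin m) (Fin m) ℂ)[X] →+* Matrix (Fin m) (Fin m) ℂ :=
  ((evalRingHom z).mapMatrix).comp
    (matPolyEquiv (R := ℂ) (n := Fin m)).symm.toRingEquiv.toRingHom

lemma fvEv_C (m : ℕ) (z : ℂ) (A : Matrix (Fin m) (Fin m) ℂ) : fvEv m z (C A) = A := by
  ext i j
  simp [fvEv]

lemma fvEv_X (m : ℕ) (z : ℂ) : fvEv m z X = z • (1 : Matrix (Fin m) (Fin m) ℂ) := by
  ext i j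
  by_cases h : i = j <;> simp [fvEv, h]

lemma fvEv_det (m : ℕ) (z : ℂ) (P : (Matrix (Fin m) (Fin m) ℂ)[X]) :
    (fvEv m z P).det = (matPolyEquiv.symm P).det.eval z := by
  simp only [fvEv, RingHom.comp_apply]
  rw [← RingHom.map_det]
  rfl

lemma fv_det_lin (m : ℕ) (A : Matrix (Fin m) (Fin m) ℂ) :
    (matPolyEquiv.symm (X - C A)).det = A.charpoly := by
  rw [Matrix.charpoly, Matrix.charmatrix, map_sub, matPolyEquiv_symm_X, matPolyEquiv_symm_C]
  rfl

/-- block companion map acting on rows -/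
noncomputable def fvT (m N : ℕ) (P : (Matrix (Fin m) (Fin m) ℂ)[X]) :
    Module.End ℂ (Fin N → Fin m → ℂ) where
  toFun u := fun k => if h : (k : ℕ) + 1 < N then u ⟨k + 1, h⟩
    else - ∑ j : Fin N, Matrix.vecMul (u j) (P.coeff j)
  map_add' u v := by
    funext k
    by_cases h : (k : ℕ) + 1 < N
    · simp [h]
    · simp [h, Matrix.add_vecMul, Finset.sum_add_distrib, add_comm]
  map_smul' c u := by
    funext k
    by_cases h : (k : ℕ) + 1 < N
    · simp [h]
    · simp [h, Matrix.smul_vecMul, Finset.smul_sum]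

lemma fv_eig (m N : ℕ) (P : (Matrix (Fin m) (Fin m) ℂ)[X]) (hP : P.Monic)
    (hN : P.natDegree = N) (z : ℂ) (u : Fin m → ℂ) (hu : Matrix.vecMul u (fvEv m z P) = 0) :
    fvT m N P (fun k => z ^ (k : ℕ) • u) = z • (fun k : Fin N => z ^ (k : ℕ) • u) := by
  funext k
  by_cases h : (k : ℕ) + 1 < N
  · simp [fvT, h, pow_succ', mul_smul]
  · have hk : (k : ℕ) + 1 = N := by omega
    have hs : fvEv m z P = z ^ N • (1 : Matrix (Fin m) (Fin m) ℂ)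
        + ∑ j ∈ Finset.range N, z ^ j • P.coeff j := by
      conv_lhs => rw [hP.as_sum, hN]
      simp [fvEv_C, fvEv_X, _root_.smul_pow]
    rw [hs, Matrix.vecMul_add, Matrix.vecMul_smul, Matrix.vecMul_one,
      Matrix.vecMul_sum, Finset.sum_range] at hu
    have : fvT m N P (fun k => z ^ (k : ℕ) • u) k
      = - ∑ j : Fin N, Matrix.vecMul (z ^ (j : ℕ) • u) (P.coeff j) := by
      simp [fvT, h]
    rw [this, Pi.smul_apply, smul_smul, ← pow_succ', hk, eq_comm, eq_neg_iff_add_eq_zero, ← hu]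
    simp [Matrix.smul_vecMul, Matrix.vecMul_smul]

lemma fv_span (m N : ℕ) (hN0 : 0 < N) (P : (Matrix (Fin m) (Fin m) ℂ)[X]) (hP : P.Monic)
    (hN : P.natDegree = N) (s : Finset ℂ) (hs : s.card = m * N)
    (u : s → Fin m → ℂ) (hu0 : ∀ z, u z ≠ 0)
    (hu : ∀ z : s, Matrix.vecMul (u z) (fvEv m z P) = 0) :
    Submodule.span ℂ (Set.range u) = ⊤ := by
  have hli : LinearIndependent ℂ (fun z : s => fun k : Fin N => (z : ℂ) ^ (k : ℕ) • u z) := by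
    refine Module.End.eigenvectors_linearIndependent' (fvT m N P) (fun z : s => (z : ℂ))
      Subtype.val_injective _ ?_
    intro z
    refine ⟨Module.End.mem_eigenspace_iff.2 (fv_eig m N P hP hN z _ (hu z)), ?_⟩
    intro h0
    have := congrFun h0 ⟨0, hN0⟩
    simp at this
    exact hu0 z this
  have hsp := hli.span_eq_top_of_card_eq_finrank' (by
    simp [hs, Module.finrank_pi_fintype, mul_comm])
  have h2 := congrArg (Submodule.map
    (LinearMap.proj (R := ℂ) (φ := fun _ : Fin N => Fin m → ℂ) ⟨0, hN0⟩)) hsp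
  rw [Submodule.map_span, Submodule.map_top, LinearMap.range_eq_top.2
    (LinearMap.proj_surjective _), ← Set.range_comp] at h2
  convert h2 using 3
  funext z
  simp

lemma fv_main (m : ℕ) (hm : 0 < m) : ∀ (n : ℕ) (P : (Matrix (Fin m) (Fin m) ℂ)[X]), P.Monic →
    P.natDegree = n → ∀ s : Finset ℂ, s.card = m * n →
    (matPolyEquiv.symm P).det = ∏ z ∈ s, (X - C z) →
    ∃ A : Fin n → Matrix (Fin m) (Fin m) ℂ, P = (List.ofFn fun i => X - C (A i)).prod := by
  haveI : Nonempty (Fin m) := ⟨⟨0, hm⟩⟩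
  intro n
  induction n with
  | zero =>
    intro P hP hd s _ _
    exact ⟨fun _ => 0, by simpa using hP.natDegree_eq_zero.1 hd⟩
  | succ n ih =>
    intro P hP hd s hs hdet
    have hex : ∀ z : s, ∃ v, v ≠ 0 ∧ Matrix.vecMul v (fvEv m z P) = 0 := by
      intro z
      rw [Matrix.exists_vecMul_eq_zero_iff, fvEv_det, hdet, eval_prod]
      exact Finset.prod_eq_zero z.2 (by simp)
    choose u hu0 hu using hex
    have hsp := fv_span m (n + 1) (Nat.succ_pos n) P hP hd s hs u hu0 hu
    obtain ⟨κ, a, ha, hspa, hli⟩ := exists_linearIndependent' ℂ u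
    rw [hsp] at hspa
    let b := Module.Basis.mk hli hspa.ge
    haveI : Fintype κ := Fintype.ofInjective a ha
    have hcard : Fintype.card κ = m := by
      rw [← Module.finrank_eq_card_basis b]; simp
    let e : Fin m ≃ κ := (Fintype.equivFinOfCardEq hcard).symm
    let c : Fin m → s := a ∘ e
    have hc : Function.Injective c := ha.comp e.injective
    let d : Fin m → ℂ := fun i => (c i : ℂ)
    have hdinj : Function.Injective d := Subtype.val_injective.comp hc
    let U : Matrix (Fin m) (Fin m) ℂ := Matrix.of fun i => u (c i)
    have hU : IsUnit U := by
      rw [← Matrix.linearIndependent_rows_iff_isUnit]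
      exact hli.comp e e.injective
    have hUdet : IsUnit U.det := (Matrix.isUnit_iff_isUnit_det U).1 hU
    let A := U⁻¹ * Matrix.diagonal d * U
    have hchar : A.charpoly = ∏ i, (X - C (d i)) := by
      obtain ⟨V, hV⟩ := hU
      have := Matrix.charpoly_units_conj' V (Matrix.diagonal d)
      rw [Matrix.charpoly_diagonal] at this
      rw [← this]
      simp [A, ← hV]
    have hUA : U * A = Matrix.diagonal d * U := by
      simp only [A]
      rw [← mul_assoc, ← mul_assoc, Matrix.mul_nonsing_inv _ hUdet, one_mul]
    have hrow : ∀ i, Matrix.vecMul (u (c i)) A = d i • u (c i) := by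
      intro i
      have := congrFun hUA i
      rw [Matrix.mul_apply_eq_vecMul] at this
      rw [show u (c i) = U i from rfl, this]
      ext j
      simp
    have hmon : (X - C A).Monic := monic_X_sub_C A
    have hdiv := modByMonic_add_div P (X - C A)
    have hlt := degree_modByMonic_lt P hmon
    rw [degree_X_sub_C] at hlt
    obtain ⟨R, hR⟩ : ∃ R, P %ₘ (X - C A) = C R :=
      ⟨_, eq_C_of_degree_le_zero (by
        rw [degree_le_iff_coeff_zero]
        intro k hk
        refine coeff_eq_zero_of_degree_lt (hlt.trans_le ?_)
        have hk' : 0 < k := by exact_mod_cast hk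
        exact_mod_cast (hk' : 1 ≤ k))⟩
    set Q := P /ₘ (X - C A) with hQ
    have hR0 : R = 0 := by
      have hUR : U * R = 0 := by
        funext i
        have h1 := hu (c i)
        rw [← hdiv, hR, map_add, map_mul, map_sub, fvEv_C, fvEv_C, fvEv_X, Matrix.vecMul_add,
          ← Matrix.vecMul_vecMul, Matrix.vecMul_sub, hrow i, Matrix.vecMul_smul,
          Matrix.vecMul_one] at h1
        simp only [d, sub_self, Matrix.zero_vecMul, add_zero] at h1
        rw [Matrix.mul_apply_eq_vecMul]
        exact h1
      exact hU.mul_right_eq_zero.1 hUR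
    rw [hR, hR0, C_0, zero_add] at hdiv
    have hQm : Q.Monic := Monic.of_mul_monic_left hmon (by rw [hdiv]; exact hP)
    have hQd : Q.natDegree = n := by
      rw [hQ, natDegree_divByMonic _ hmon, hd, natDegree_X_sub_C]; rfl
    let t : Finset ℂ := Finset.univ.image d
    have hts : t ⊆ s := by
      intro z hz
      obtain ⟨i, _, rfl⟩ := Finset.mem_image.1 hz
      exact (c i).2
    have htc : t.card = m := by
      simp [t, Finset.card_image_of_injective _ hdinj]
    have htp : ∏ z ∈ t, (X - C z) = A.charpoly := by
      rw [hchar, Finset.prod_image (fun x _ y _ h => hdinj h)]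
    obtain ⟨B, hB⟩ := ih Q hQm hQd (s \ t)
      (by rw [Finset.card_sdiff_of_subset hts, hs, htc, Nat.mul_succ, Nat.add_sub_cancel]) (by
        rw [← hdiv, map_mul, Matrix.det_mul, fv_det_lin, ← Finset.prod_sdiff hts, htp,
          mul_comm] at hdet
        exact mul_right_cancel₀ (Matrix.charpoly_monic A).ne_zero hdet)
    refine ⟨Fin.cons A B, ?_⟩
    rw [List.ofFn_succ, List.prod_cons]
    simp only [Fin.cons_zero, Fin.cons_succ]
    rw [← hB, hdiv]

/-- **Factorization of generic matrix polynomials into linear factors.** Let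
`P(z) = zⁿI + P₁zⁿ⁻¹ + ⋯ + Pₙ` be a monic matrix polynomial whose determinant has
`m·n` pairwise distinct roots. Then `P(z)` decomposes into linear factors:
`P(z) = (zI − A₁)·(zI − A₂)·⋯·(zI − Aₙ)` for some matrices `A₁, …, Aₙ`. -/
theorem factorization_into_linear_factors
    (m n : ℕ) (Pc : ℕ → Matrix (Fin m) (Fin m) ℂ) (hP0 : Pc 0 = 1)
    (P : Matrix (Fin m) (Fin m) (Polynomial ℂ))
    (hP : P = ∑ k ∈ Finset.range (n + 1),
      ((Polynomial.X : Polynomial ℂ) ^ (n - k)) • (Pc k).map Polynomial.C)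
    (ρ : Fin (m * n) → ℂ) (hρ : Function.Injective ρ)
    (hdet : P.det = ∏ i, (Polynomial.X - Polynomial.C (ρ i))) :
    ∃ A : Fin n → Matrix (Fin m) (Fin m) ℂ,
      P = (List.ofFn (fun i : Fin n =>
        (Polynomial.X : Polynomial ℂ) • (1 : Matrix (Fin m) (Fin m) (Polynomial ℂ))
          - (A i).map Polynomial.C)).prod := by
  rcases Nat.eq_zero_or_pos m with rfl | hm
  · exact ⟨fun _ => 0, Subsingleton.elim _ _⟩
  haveI : Nonempty (Fin m) := ⟨⟨0, hm⟩⟩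
  have hcoe : matPolyEquiv P = X ^ n + ∑ k ∈ Finset.range n, C (Pc (k + 1)) * X ^ (n - (k + 1)) := by
    rw [hP, Finset.sum_range_succ', map_add, map_sum, add_comm]
    have key : ∀ (j : ℕ) (M : Matrix (Fin m) (Fin m) ℂ),
        matPolyEquiv ((X : ℂ[X]) ^ j • M.map C) = C M * X ^ j := by
      intro j M
      apply matPolyEquiv.symm.injective
      rw [AlgEquiv.symm_apply_apply, map_mul, map_pow, matPolyEquiv_symm_X, matPolyEquiv_symm_C,
        Matrix.diagonal_pow]
      ext1 a b
      rw [Matrix.mul_diagonal, Matrix.smul_apply, smul_eq_mul, mul_comm]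
      rfl
    simp only [key, hP0, C_1, one_mul, Nat.sub_zero]
  have hlt : (∑ k ∈ Finset.range n, C (Pc (k + 1)) * X ^ (n - (k + 1))).degree < (n : WithBot ℕ) := by
    refine (degree_sum_le _ _).trans_lt ((Finset.sup_lt_iff (WithBot.bot_lt_coe n)).2 ?_)
    intro k hk
    refine (degree_C_mul_X_pow_le _ _).trans_lt ?_
    have := Finset.mem_range.1 hk
    exact Nat.cast_lt.2 (by omega : n - (k + 1) < n)
  have hmon : (matPolyEquiv P).Monic := by
    rw [hcoe]; exact monic_X_pow_add hlt
  have hdeg : (matPolyEquiv P).natDegree = n := by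
    rw [hcoe]
    exact natDegree_eq_of_degree_eq_some (by
      rw [degree_add_eq_left_of_degree_lt (by rwa [degree_X_pow]), degree_X_pow])
  obtain ⟨A, hA⟩ := fv_main m hm n (matPolyEquiv P) hmon hdeg (Finset.univ.image ρ)
    (by simp [Finset.card_image_of_injective _ hρ])
    (by rw [AlgEquiv.symm_apply_apply, hdet, Finset.prod_image (fun x _ y _ h => hρ h)])
  refine ⟨A, ?_⟩
  have h2 := congrArg matPolyEquiv.symm hA
  rw [AlgEquiv.symm_apply_apply, map_list_prod, List.map_ofFn] at h2
  rw [h2]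
  congr 2
  funext i
  simp only [Function.comp_apply, map_sub, matPolyEquiv_symm_X, matPolyEquiv_symm_C,
    Matrix.smul_one_eq_diagonal]
end

section
/- Let P(z) be a monic m×m matrix polynomial of degree n whose determinant det P(z) has mn pairwise distinct roots. Suppose P(z) = (zI − A_1)·⋯·(zI − A_n) = (zI − A'_1)·⋯·(zI − A'_n) are two decompositions into linear factors with A_i, A'_i ∈ Mat_m(ℂ), such that for every i = 1, …, n the set of eigenvalues of A_i equals the set of eigenvalues of A'_i. Then A_i = A'_i for all i = 1, …, n. -/
open Polynomial

lemma aux_charpoly {m : ℕ} (A B : Matrix (Fin m) (Fin m) ℂ) (hA : A.charpoly.Separable)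
    (hB : B.charpoly.Separable) (h : spectrum ℂ A = spectrum ℂ B) : A.charpoly = B.charpoly := by
  have hr : A.charpoly.roots = B.charpoly.roots := by
    rw [Multiset.Nodup.ext (nodup_roots hA) (nodup_roots hB)]
    intro a
    rw [mem_roots A.charpoly_monic.ne_zero, mem_roots B.charpoly_monic.ne_zero,
      ← Matrix.mem_spectrum_iff_isRoot_charpoly, ← Matrix.mem_spectrum_iff_isRoot_charpoly, h]
  rw [(IsAlgClosed.splits A.charpoly).eq_prod_roots_of_monic A.charpoly_monic,
    (IsAlgClosed.splits B.charpoly).eq_prod_roots_of_monic B.charpoly_monic, hr]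

lemma aux_last {m : ℕ} (A B : Matrix (Fin m) (Fin m) ℂ) (Q Q' : Matrix (Fin m) (Fin m) ℂ[X])
    (h : Q * A.charmatrix = Q' * B.charmatrix) (hc : A.charpoly = B.charpoly)
    (hs : IsCoprime Q.det A.charpoly) : A = B := by
  have h1 : Q.det • (A.charmatrix * B.charmatrix.adjugate) =
      B.charpoly • (Q.adjugate * Q') := by
    have e := congrArg (fun M => Q.adjugate * M * B.charmatrix.adjugate) h
    rw [← mul_assoc, Matrix.adjugate_mul, mul_assoc, mul_assoc, mul_assoc,
      Matrix.mul_adjugate] at e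
    simpa [Matrix.charpoly] using e
  have h2 : ∃ R, A.charmatrix * B.charmatrix.adjugate = B.charpoly • R := by
    have : ∀ i j, ∃ r, (A.charmatrix * B.charmatrix.adjugate) i j = B.charpoly * r := by
      intro i j
      rw [hc] at hs
      refine hs.symm.dvd_of_dvd_mul_left ⟨(Q.adjugate * Q') i j, ?_⟩
      simpa using congrFun (congrFun h1 i) j
    choose R hR using this
    exact ⟨Matrix.of R, by ext1 i j; simp [hR]⟩
  obtain ⟨R, hR⟩ := h2
  have h3 : A.charmatrix = R * B.charmatrix := by
    have e := congrArg (fun M => M * B.charmatrix) hR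
    rw [mul_assoc, Matrix.adjugate_mul, Matrix.smul_mul] at e
    have e' : B.charpoly • A.charmatrix = B.charpoly • (R * B.charmatrix) := by
      simpa [Matrix.charpoly] using e
    ext1 i j
    have := congrFun (congrFun e' i) j
    exact mul_left_cancel₀ B.charpoly_monic.ne_zero (by simpa using this)
  have h4 := congrArg matPolyEquiv h3
  rw [map_mul, Matrix.matPolyEquiv_charmatrix, Matrix.matPolyEquiv_charmatrix] at h4
  have h5 := congrArg (eval B) h4
  rw [eval_mul_X_sub_C] at h5
  simp only [eval_sub, eval_X, eval_C] at h5
  exact (sub_eq_zero.mp h5).symm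

lemma aux_main (m n : ℕ) : ∀ (A A' : Fin n → Matrix (Fin m) (Fin m) ℂ),
    (List.ofFn fun i => (A i).charmatrix).prod.det.Separable →
    (List.ofFn fun i => (A i).charmatrix).prod = (List.ofFn fun i => (A' i).charmatrix).prod →
    (∀ i, spectrum ℂ (A i) = spectrum ℂ (A' i)) → A = A' := by
  induction n with
  | zero => intro A A' _ _ _; exact Subsingleton.elim _ _
  | succ n ih =>
    intro A A' hs h hspec
    have hs' := hs
    rw [h] at hs'
    simp only [List.ofFn_succ', List.concat_eq_append, List.prod_append, List.prod_cons,
      List.prod_nil, mul_one, Matrix.det_mul] at hs hs' h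
    have hc := aux_charpoly (A (Fin.last n)) (A' (Fin.last n)) hs.of_mul_right hs'.of_mul_right
      (hspec _)
    have hl := aux_last _ _ _ _ h hc hs.isCoprime
    have hQ := h
    rw [← hl] at hQ
    have hi := ih (fun i => A i.castSucc) (fun i => A' i.castSucc) hs.of_mul_left (by
      have e := congrArg (fun M => M * (A (Fin.last n)).charmatrix.adjugate) hQ
      simp only [mul_assoc, Matrix.mul_adjugate] at e
      ext1 i j
      have := congrFun (congrFun e i) j
      exact mul_left_cancel₀ (A (Fin.last n)).charpoly_monic.ne_zero
        (by simpa [Matrix.charpoly] using this)) (fun i => hspec _)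
    funext i
    refine Fin.lastCases hl (fun j => congrFun hi j) i

/-- **Uniqueness of the factorization with prescribed spectra.** Let `P(z)` be a monic
matrix polynomial of degree `n` whose determinant has `m·n` pairwise distinct roots, and
suppose `P(z) = (zI − A₁)⋯(zI − Aₙ) = (zI − A'₁)⋯(zI − A'ₙ)` are two factorizations into
linear factors such that the set of eigenvalues of `Aᵢ` equals that of `A'ᵢ` for each `i`.
Then `Aᵢ = A'ᵢ` for all `i`. -/
theorem factorization_unique_of_spectra
    (m n : ℕ) (Pc : ℕ → Matrix (Fin m) (Fin m) ℂ) (hP0 : Pc 0 = 1)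
    (P : Matrix (Fin m) (Fin m) (Polynomial ℂ))
    (hP : P = ∑ k ∈ Finset.range (n + 1),
      ((Polynomial.X : Polynomial ℂ) ^ (n - k)) • (Pc k).map Polynomial.C)
    (ρ : Fin (m * n) → ℂ) (hρ : Function.Injective ρ)
    (hdet : P.det = ∏ i, (Polynomial.X - Polynomial.C (ρ i)))
    (A A' : Fin n → Matrix (Fin m) (Fin m) ℂ)
    (hA : P = (List.ofFn (fun i : Fin n =>
        (Polynomial.X : Polynomial ℂ) • (1 : Matrix (Fin m) (Fin m) (Polynomial ℂ))
          - (A i).map Polynomial.C)).prod)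
    (hA' : P = (List.ofFn (fun i : Fin n =>
        (Polynomial.X : Polynomial ℂ) • (1 : Matrix (Fin m) (Fin m) (Polynomial ℂ))
          - (A' i).map Polynomial.C)).prod)
    (hspec : ∀ i, spectrum ℂ (A i) = spectrum ℂ (A' i)) :
    A = A' := by
  have key : ∀ M : Matrix (Fin m) (Fin m) ℂ,
      (Polynomial.X : Polynomial ℂ) • (1 : Matrix (Fin m) (Fin m) (Polynomial ℂ))
          - M.map Polynomial.C = M.charmatrix := by
    intro M
    rw [Matrix.charmatrix, Matrix.smul_one_eq_diagonal]
    rfl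
  simp only [key] at hA hA'
  refine aux_main m n A A' ?_ (hA.symm.trans hA') hspec
  rw [← hA, hdet]
  exact (separable_prod_X_sub_C_iff).2 hρ
end

section
/- Let A, B ∈ Mat_m(ℂ) be matrices whose eigenvalues are λ_1, …, λ_m and μ_1, …, μ_m respectively, where all 2m numbers λ_1, …, λ_m, μ_1, …, μ_m are pairwise distinct. Let v ∈ ℂ^m be nonzero with A v = λ_1 v and u ∈ ℂ^m be nonzero with uᵀB = μ_1 uᵀ. Suppose there exist matrices Ã, B̃ ∈ Mat_m(ℂ) with à + B̃ = A + B and ÃB̃ = AB (equivalently, (zI − A)(zI − B) = (zI − Ã)(zI − B̃) as matrix polynomials), such that the eigenvalues of à are {μ_1, λ_2, …, λ_m} and the eigenvalues of B̃ are {λ_1, μ_2, …, μ_m}. Then uᵀv ≠ 0. -/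
open Polynomial Matrix

theorem key_sylvester {m : ℕ} (M N Y : Matrix (Fin m) (Fin m) ℂ) (a : ℂ) (q : ℂ[X])
    (h : M * Y = Y * N) (hN : N.charpoly = (X - C a) * q) (hq : IsCoprime q M.charpoly) :
    M * Y = a • Y := by
  have hp : ∀ p : ℂ[X], aeval M p * Y = Y * aeval N p := by
    intro p
    induction p using Polynomial.induction_on' with
    | add p q hp hq => simp [add_mul, mul_add, hp, hq]
    | monomial n c =>
      have hn : M ^ n * Y = Y * N ^ n := by
        induction n with
        | zero => simp
        | succ n ih => rw [pow_succ, Matrix.mul_assoc, h, ← Matrix.mul_assoc, ih, Matrix.mul_assoc, ← pow_succ]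
      simp [aeval_monomial, Algebra.algebraMap_eq_smul_one, hn]
  have h0 := hp N.charpoly
  rw [Matrix.aeval_self_charpoly, Matrix.mul_zero, hN, mul_comm, map_mul, Matrix.mul_assoc] at h0
  obtain ⟨x, y, hxy⟩ := hq
  have h1 := congrArg (aeval M) hxy
  simp only [map_add, map_mul, Matrix.aeval_self_charpoly, mul_zero, add_zero, map_one] at h1
  have h2 : aeval M (X - C a) * Y = 0 := by
    calc _ = (aeval M x * aeval M q) * (aeval M (X - C a) * Y) := by rw [h1, Matrix.one_mul]
      _ = 0 := by rw [Matrix.mul_assoc, h0, Matrix.mul_zero]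
  simp only [map_sub, aeval_X, aeval_C, Algebra.algebraMap_eq_smul_one, sub_mul, Matrix.smul_mul, Matrix.one_mul] at h2
  exact sub_eq_zero.1 h2

theorem eig_simple {m : ℕ} (M : Matrix (Fin m) (Fin m) ℂ) (lam : Fin m → ℂ)
    (hl : Function.Injective lam)
    (hM : M.charpoly = ∏ i, (X - C (lam i))) (i : Fin m) (v w : Fin m → ℂ) (hv : v ≠ 0)
    (hMv : M *ᵥ v = lam i • v) (hMw : M *ᵥ w = lam i • w) : ∃ c : ℂ, w = c • v := by
  have h1 := LinearMap.finrank_maxGenEigenspace_eq (Matrix.toLin' M) (lam i)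
  have h2 : M.charpoly.rootMultiplicity (lam i) ≤ 1 := by
    rw [← count_roots, hM]
    have : (∏ i, (X - C (lam i))).roots = Finset.univ.val.map lam := by
      rw [Polynomial.roots_prod _ _ (Finset.prod_ne_zero_iff.2 fun i _ => X_sub_C_ne_zero _)]
      simp
    rw [this]
    exact Multiset.nodup_iff_count_le_one.1 (Finset.univ.nodup.map hl) _
  rw [Matrix.charpoly_toLin'] at h1
  rw [← h1] at h2
  have mem : ∀ x : Fin m → ℂ, M *ᵥ x = lam i • x →
      x ∈ Module.End.maxGenEigenspace (Matrix.toLin' M) (lam i) := by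
    intro x hx
    rw [Module.End.mem_maxGenEigenspace]
    exact ⟨1, by simp [hx]⟩
  obtain ⟨z, hz⟩ := finrank_le_one_iff.1 h2
  obtain ⟨c, hc⟩ := hz ⟨v, mem v hMv⟩
  obtain ⟨d, hd⟩ := hz ⟨w, mem w hMw⟩
  have hc' : c • (z : Fin m → ℂ) = v := congrArg Subtype.val hc
  have hd' : d • (z : Fin m → ℂ) = w := congrArg Subtype.val hd
  have hc0 : c ≠ 0 := by
    rintro rfl
    exact hv (by rw [← hc', zero_smul])
  refine ⟨d * c⁻¹, ?_⟩
  rw [← hc', ← hd', smul_smul, mul_assoc, inv_mul_cancel₀ hc0, mul_one]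

theorem key_rank_one {m : ℕ} (M N Y : Matrix (Fin m) (Fin m) ℂ) (lam : Fin m → ℂ) (i : Fin m)
    (q : ℂ[X]) (hl : Function.Injective lam)
    (hM : M.charpoly = ∏ i, (X - C (lam i)))
    (h : M * Y = Y * N) (hN : N.charpoly = (X - C (lam i)) * q) (hq : IsCoprime q M.charpoly)
    (v : Fin m → ℂ) (hv : v ≠ 0) (hMv : M *ᵥ v = lam i • v) :
    ∃ b : Fin m → ℂ, Y = vecMulVec v b := by
  have h1 := key_sylvester M N Y _ q h hN hq
  have : ∀ j, ∃ c : ℂ, (fun k => Y k j) = c • v := by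
    intro j
    apply eig_simple M lam hl hM i v _ hv hMv
    ext k
    exact congrFun (congrFun h1 k) j
  choose b hb using this
  refine ⟨b, ?_⟩
  ext k j
  have := congrFun (hb j) k
  simp [vecMulVec_apply, this, mul_comm]

theorem coprime_erase {m : ℕ} (s t : Finset (Fin m)) (lam mu : Fin m → ℂ)
    (h : ∀ i j, lam i ≠ mu j) :
    IsCoprime (∏ i ∈ s, (X - C (lam i))) (∏ i ∈ t, (X - C (mu i))) :=
  IsCoprime.prod_left fun i _ => IsCoprime.prod_right fun j _ =>
    isCoprime_X_sub_C_of_isUnit_sub (sub_ne_zero.2 (h i j)).isUnit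

/-- **Non-orthogonality of the exchanged eigenvectors.** Let `A, B` have eigenvalues
`λ₁, …, λ_m` and `μ₁, …, μ_m` respectively, all `2m` numbers pairwise distinct. Let
`v ≠ 0` with `Av = λ₁v` and `u ≠ 0` with `uᵀB = μ₁uᵀ`. If there exist matrices `Ã, B̃`
with `Ã + B̃ = A + B`, `ÃB̃ = AB` whose eigenvalues are `{μ₁, λ₂, …, λ_m}` and
`{λ₁, μ₂, …, μ_m}` respectively, then `uᵀv ≠ 0`. -/
theorem pairing_ne_zero_of_exchanged_factorization
    (m : ℕ) (hm : 0 < m)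
    (A B : Matrix (Fin m) (Fin m) ℂ) (lam mu : Fin m → ℂ)
    (hdistinct : Function.Injective (Sum.elim lam mu : Fin m ⊕ Fin m → ℂ))
    (hAchar : A.charpoly = ∏ i, (Polynomial.X - Polynomial.C (lam i)))
    (hBchar : B.charpoly = ∏ i, (Polynomial.X - Polynomial.C (mu i)))
    (v u : Fin m → ℂ) (hv : v ≠ 0) (hu : u ≠ 0)
    (hAv : A.mulVec v = lam ⟨0, hm⟩ • v)
    (huB : Matrix.vecMul u B = mu ⟨0, hm⟩ • u)
    (At Bt : Matrix (Fin m) (Fin m) ℂ)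
    (hsum : At + Bt = A + B) (hprod : At * Bt = A * B)
    (hAtchar : At.charpoly = (Polynomial.X - Polynomial.C (mu ⟨0, hm⟩)) *
      ∏ i ∈ Finset.univ.erase ⟨0, hm⟩, (Polynomial.X - Polynomial.C (lam i)))
    (hBtchar : Bt.charpoly = (Polynomial.X - Polynomial.C (lam ⟨0, hm⟩)) *
      ∏ i ∈ Finset.univ.erase ⟨0, hm⟩, (Polynomial.X - Polynomial.C (mu i))) :
    u ⬝ᵥ v ≠ 0 := by
  intro huv
  have hl : Function.Injective lam := fun i j h => Sum.inl_injective (hdistinct (by simpa using h))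
  have hmu : Function.Injective mu := fun i j h => Sum.inr_injective (hdistinct (by simpa using h))
  have hne : ∀ i j, lam i ≠ mu j := fun i j h => by
    have := @hdistinct (Sum.inl i) (Sum.inr j) (by simpa using h)
    cases this
  set i0 : Fin m := ⟨0, hm⟩
  have hBt : Bt = A + B - At := by rw [← hsum]; abel
  subst hBt
  rw [mul_sub, mul_add] at hprod
  obtain ⟨b, hb⟩ := key_rank_one A (A + B - At) (At - A) lam i0 _ hl hAchar
    (by
      have : (At - A) * (A + B - At) - A * (At - A)
        = (At * A + At * B - At * At) - A * B := by noncomm_ring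
      rw [hprod, sub_self] at this
      exact (sub_eq_zero.1 this).symm) hBtchar
    (by rw [hAchar]; exact coprime_erase _ _ _ _ fun i j => (hne j i).symm) v hv hAv
  obtain ⟨c, hc⟩ := key_rank_one Bᵀ Atᵀ (At - A)ᵀ mu i0 _ hmu
    (by rw [Matrix.charpoly_transpose, hBchar])
    (by
      have : (At - A) * B - At * (At - A)
        = (At * A + At * B - At * At) - A * B := by noncomm_ring
      rw [hprod, sub_self] at this
      rw [← Matrix.transpose_mul, ← Matrix.transpose_mul, sub_eq_zero.1 this])
    (by rw [Matrix.charpoly_transpose, hAtchar])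
    (by rw [Matrix.charpoly_transpose, hBchar]; exact coprime_erase _ _ _ _ hne) u hu
    (by rw [Matrix.mulVec_transpose, huB])
  have hc' : At - A = vecMulVec c u := by
    rw [← Matrix.transpose_transpose (At - A), hc, Matrix.transpose_vecMulVec]
  have e1 : (At - A) *ᵥ v = 0 := by
    rw [hc', Matrix.vecMulVec_mulVec, huv]; simp
  have e2 : b ⬝ᵥ v = 0 := by
    rw [hb, Matrix.vecMulVec_mulVec] at e1
    obtain ⟨k, hk⟩ := Function.ne_iff.1 hv
    have := congrFun e1 k
    simp at this
    exact this.resolve_left hk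
  have tr : (At - A).trace = 0 := by
    rw [hb, Matrix.trace_vecMulVec, dotProduct_comm, e2]
  have hpoly : At.charpoly * (X - C (lam i0)) = A.charpoly * (X - C (mu i0)) := by
    rw [hAtchar, hAchar, ← Finset.mul_prod_erase Finset.univ _ (Finset.mem_univ i0)]
    ring
  have hr := congrArg (fun p => p.roots.sum) hpoly
  rw [roots_mul (mul_ne_zero At.charpoly_monic.ne_zero (X_sub_C_ne_zero _)),
    roots_mul (mul_ne_zero A.charpoly_monic.ne_zero (X_sub_C_ne_zero _)), Multiset.sum_add,
    Multiset.sum_add, ← Matrix.trace_eq_sum_roots_charpoly, ← Matrix.trace_eq_sum_roots_charpoly,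
    roots_X_sub_C, roots_X_sub_C, Multiset.sum_singleton, Multiset.sum_singleton] at hr
  rw [Matrix.trace_sub, sub_eq_zero] at tr
  rw [tr] at hr
  exact hne _ _ (add_left_cancel hr)
end

section
/- Let A, B ∈ Mat_m(ℂ) be matrices whose eigenvalues are λ_1, …, λ_m and μ_1, …, μ_m respectively, where all 2m numbers are pairwise distinct. Let v, u ∈ ℂ^m be nonzero with A v = λ_1 v and uᵀB = μ_1 uᵀ, and assume uᵀv ≠ 0. Define T = (v uᵀ)/(uᵀv) ∈ Mat_m(ℂ) (the rank-one projector with T² = T, A T = λ_1 T, T B = μ_1 T), and set à = A + (μ_1 − λ_1)T and B̃ = B + (λ_1 − μ_1)T. Then: (i) à + B̃ = A + B and ÃB̃ = AB, so (zI − A)(zI − B) = (zI − Ã)(zI − B̃); (ii) à v = μ_1 v and uᵀB̃ = λ_1 uᵀ; (iii) the eigenvalues of à are {μ_1, λ_2, …, λ_m} and the eigenvalues of B̃ are {λ_1, μ_2, …, μ_m}. -/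
open Polynomial Matrix

theorem exch_aux {m : ℕ} (A : Matrix (Fin m) (Fin m) ℂ) (v w : Fin m → ℂ) (l : ℂ)
    (q : Polynomial ℂ) (hA : A.mulVec v = l • v)
    (hq : A.charpoly = (Polynomial.X - Polynomial.C l) * q) :
    (A + Matrix.vecMulVec v w).charpoly
      = (Polynomial.X - Polynomial.C (l + w ⬝ᵥ v)) * q := by
  apply Polynomial.eq_of_infinite_eval_eq
  refine Set.Infinite.mono ?_ (Set.Finite.infinite_compl (Set.finite_singleton l))
  intro z hz
  have hz' : z - l ≠ 0 := sub_ne_zero.mpr hz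
  have h1 : Matrix.scalar (Fin m) z - (A + Matrix.vecMulVec v w)
      = (Matrix.scalar (Fin m) z - A) *
        (1 + Matrix.replicateCol Unit (-(z - l)⁻¹ • v) * Matrix.replicateRow Unit w) := by
    rw [← Matrix.vecMulVec_eq, Matrix.mul_add, Matrix.mul_one, Matrix.mul_vecMulVec,
      Matrix.mulVec_smul, Matrix.sub_mulVec, hA]
    have : (Matrix.scalar (Fin m) z).mulVec v = z • v := by
      ext i; simp [Matrix.mulVec_diagonal]
    rw [this, ← sub_smul, smul_smul, neg_mul, inv_mul_cancel₀ hz']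
    rw [neg_smul, one_smul, Matrix.neg_vecMulVec]
    abel
  have h2 : (Matrix.scalar (Fin m) z - A).det = (z - l) * q.eval z := by
    rw [← Matrix.eval_charpoly, hq]; simp
  simp only [Set.mem_ofPred_eq]
  rw [Matrix.eval_charpoly, h1, Matrix.det_mul, h2,
    Matrix.det_one_add_replicateCol_mul_replicateRow]
  simp only [dotProduct_smul, Polynomial.eval_mul, Polynomial.eval_sub, Polynomial.eval_X,
    Polynomial.eval_C, smul_eq_mul]
  field_simp
  ring

set_option maxHeartbeats 400000 in
/-- **Exchange of eigenvalues between adjacent linear factors.** Let `A, B` have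
eigenvalues `λ₁, …, λ_m` and `μ₁, …, μ_m`, all `2m` numbers pairwise distinct, let
`v ≠ 0`, `u ≠ 0` with `Av = λ₁v`, `uᵀB = μ₁uᵀ` and `uᵀv ≠ 0`. Set
`T = (v uᵀ)/(uᵀv)`, `Ã = A + (μ₁ − λ₁)T`, `B̃ = B + (λ₁ − μ₁)T`. Then `T` is a
rank-one projector with `T² = T`, `AT = λ₁T`, `TB = μ₁T`; moreover
(i) `Ã + B̃ = A + B` and `ÃB̃ = AB`, hence `(zI−A)(zI−B) = (zI−Ã)(zI−B̃)`;
(ii) `Ãv = μ₁v` and `uᵀB̃ = λ₁uᵀ`;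
(iii) the eigenvalues of `Ã` are `{μ₁, λ₂, …, λ_m}` and those of `B̃` are
`{λ₁, μ₂, …, μ_m}`. -/
theorem exchange_of_eigenvalues
    (m : ℕ) (hm : 0 < m)
    (A B : Matrix (Fin m) (Fin m) ℂ) (lam mu : Fin m → ℂ)
    (hdistinct : Function.Injective (Sum.elim lam mu : Fin m ⊕ Fin m → ℂ))
    (hAchar : A.charpoly = ∏ i, (Polynomial.X - Polynomial.C (lam i)))
    (hBchar : B.charpoly = ∏ i, (Polynomial.X - Polynomial.C (mu i)))
    (v u : Fin m → ℂ) (hv : v ≠ 0) (hu : u ≠ 0)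
    (hAv : A.mulVec v = lam ⟨0, hm⟩ • v)
    (huB : Matrix.vecMul u B = mu ⟨0, hm⟩ • u)
    (huv : u ⬝ᵥ v ≠ 0)
    (T At Bt : Matrix (Fin m) (Fin m) ℂ)
    (hT : T = (u ⬝ᵥ v)⁻¹ • Matrix.vecMulVec v u)
    (hAt : At = A + (mu ⟨0, hm⟩ - lam ⟨0, hm⟩) • T)
    (hBt : Bt = B + (lam ⟨0, hm⟩ - mu ⟨0, hm⟩) • T) :
    T * T = T ∧ A * T = lam ⟨0, hm⟩ • T ∧ T * B = mu ⟨0, hm⟩ • T ∧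
    At + Bt = A + B ∧ At * Bt = A * B ∧
    ((Polynomial.X : Polynomial ℂ) • (1 : Matrix (Fin m) (Fin m) (Polynomial ℂ))
        - A.map Polynomial.C) *
      ((Polynomial.X : Polynomial ℂ) • (1 : Matrix (Fin m) (Fin m) (Polynomial ℂ))
        - B.map Polynomial.C)
      = ((Polynomial.X : Polynomial ℂ) • (1 : Matrix (Fin m) (Fin m) (Polynomial ℂ))
          - At.map Polynomial.C) *
        ((Polynomial.X : Polynomial ℂ) • (1 : Matrix (Fin m) (Fin m) (Polynomial ℂ))
          - Bt.map Polynomial.C) ∧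
    At.mulVec v = mu ⟨0, hm⟩ • v ∧
    Matrix.vecMul u Bt = lam ⟨0, hm⟩ • u ∧
    At.charpoly = (Polynomial.X - Polynomial.C (mu ⟨0, hm⟩)) *
      ∏ i ∈ Finset.univ.erase ⟨0, hm⟩, (Polynomial.X - Polynomial.C (lam i)) ∧
    Bt.charpoly = (Polynomial.X - Polynomial.C (lam ⟨0, hm⟩)) *
      ∏ i ∈ Finset.univ.erase ⟨0, hm⟩, (Polynomial.X - Polynomial.C (mu i)) := by
  set l := lam ⟨0, hm⟩ with hl
  set k := mu ⟨0, hm⟩ with hk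
  have hTv : T.mulVec v = v := by
    rw [hT, Matrix.smul_mulVec, Matrix.vecMulVec_mulVec]
    ext i; simp; field_simp
  have huT : Matrix.vecMul u T = u := by
    rw [hT, Matrix.vecMul_smul, Matrix.vecMul_vecMulVec, smul_smul, inv_mul_cancel₀ huv, one_smul]
  have hTT : T * T = T := by
    conv_lhs => arg 1; rw [hT]
    rw [Matrix.smul_mul, Matrix.vecMulVec_mul, huT, ← hT]
  have hAT : A * T = l • T := by
    rw [hT, Matrix.mul_smul, Matrix.mul_vecMulVec, hAv, Matrix.smul_vecMulVec, smul_comm]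
  have hTB : T * B = k • T := by
    rw [hT, Matrix.smul_mul, Matrix.vecMulVec_mul, huB, Matrix.vecMulVec_smul, smul_comm]
  have hsum : At + Bt = A + B := by
    rw [hAt, hBt]; module
  have hprod : At * Bt = A * B := by
    rw [hAt, hBt]
    simp only [Matrix.add_mul, Matrix.mul_add, Matrix.smul_mul, Matrix.mul_smul, hAT, hTB, hTT]
    module
  have hpe : ∀ f : Fin m → ℂ, ∏ i, (Polynomial.X - Polynomial.C (f i))
      = (Polynomial.X - Polynomial.C (f ⟨0, hm⟩)) *
        ∏ i ∈ Finset.univ.erase ⟨0, hm⟩, (Polynomial.X - Polynomial.C (f i)) := by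
    intro f
    have h := Finset.mul_prod_erase (Finset.univ : Finset (Fin m))
      (fun i => (Polynomial.X - Polynomial.C (f i) : Polynomial ℂ))
      (a := (⟨0, hm⟩ : Fin m)) (Finset.mem_univ _)
    rw [← h]
  refine ⟨hTT, hAT, hTB, hsum, hprod, ?_, ?_, ?_, ?_, ?_⟩
  · have e1 : A.map Polynomial.C + B.map Polynomial.C
        = At.map Polynomial.C + Bt.map Polynomial.C := by
      rw [← Matrix.map_add _ (fun a b => Polynomial.C_add), ← hsum,
        Matrix.map_add _ (fun a b => Polynomial.C_add)]
    have e2 : A.map Polynomial.C * B.map Polynomial.C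
        = At.map Polynomial.C * Bt.map Polynomial.C := by
      rw [← Matrix.map_mul, ← Matrix.map_mul, hprod]
    have key : ∀ P Q : Matrix (Fin m) (Fin m) (Polynomial ℂ),
        ((Polynomial.X : Polynomial ℂ) • (1 : Matrix (Fin m) (Fin m) (Polynomial ℂ)) - P) *
        ((Polynomial.X : Polynomial ℂ) • (1 : Matrix (Fin m) (Fin m) (Polynomial ℂ)) - Q)
        = ((Polynomial.X : Polynomial ℂ) * Polynomial.X) •
            (1 : Matrix (Fin m) (Fin m) (Polynomial ℂ))
          - (Polynomial.X : Polynomial ℂ) • (P + Q) + P * Q := by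
      intro P Q
      simp only [Matrix.sub_mul, Matrix.mul_sub, Matrix.smul_mul, Matrix.mul_smul,
        Matrix.one_mul, Matrix.mul_one, smul_sub, mul_smul, smul_add]
      abel
    rw [key, key, e1, e2]
  · rw [hAt, Matrix.add_mulVec, Matrix.smul_mulVec, hTv, hAv]; module
  · rw [hBt, Matrix.vecMul_add, Matrix.vecMul_smul, huT, huB]; module
  · have h := exch_aux A v (((k - l) * (u ⬝ᵥ v)⁻¹) • u) l _ hAv
      (hAchar.trans (hpe lam))
    rw [Matrix.vecMulVec_smul, ← smul_smul, ← hT, ← hAt, smul_dotProduct, smul_eq_mul,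
      mul_assoc, inv_mul_cancel₀ huv, mul_one, add_sub_cancel] at h
    exact h
  · have h := exch_aux Bᵀ u (((l - k) * (u ⬝ᵥ v)⁻¹) • v) k _
      (by rw [Matrix.mulVec_transpose, huB])
      ((Matrix.charpoly_transpose B).trans (hBchar.trans (hpe mu)))
    have hBt' : Bᵀ + Matrix.vecMulVec u (((l - k) * (u ⬝ᵥ v)⁻¹) • v) = Btᵀ := by
      rw [hBt, hT, Matrix.transpose_add, Matrix.transpose_smul, Matrix.transpose_smul,
        Matrix.transpose_vecMulVec, Matrix.vecMulVec_smul, smul_smul]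
    rw [hBt', Matrix.charpoly_transpose, smul_dotProduct, smul_eq_mul, dotProduct_comm v u,
      mul_assoc, inv_mul_cancel₀ huv, mul_one, add_sub_cancel] at h
    exact h
end

section
/- Let A, B ∈ Mat_m(ℂ), let λ, μ ∈ ℂ, let v, u ∈ ℂ^m be nonzero with A v = λ v and uᵀB = μ uᵀ, and assume uᵀv ≠ 0. Set T = (v uᵀ)/(uᵀv) and à = A + (μ − λ)T. Suppose v_i ∈ ℂ^m satisfies A v_i = λ_i v_i with λ_i ≠ μ. Then the vector ṽ_i = v_i + ((μ − λ)/(λ_i − μ))·((uᵀv_i)/(uᵀv))·v satisfies à ṽ_i = λ_i ṽ_i. Similarly, if u_i ∈ ℂ^m satisfies u_iᵀ B = μ_i u_iᵀ with μ_i ≠ λ, then with B̃ = B + (λ − μ)T the vector ũ_i = u_i + ((λ − μ)/(μ_i − λ))·((u_iᵀv)/(uᵀv))·u satisfies ũ_iᵀ B̃ = μ_i ũ_iᵀ. -/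
open Matrix

/-- **Eigenvectors of the exchanged factors.** Let `Av = λv`, `uᵀB = μuᵀ` with
`uᵀv ≠ 0`, and set `T = (v uᵀ)/(uᵀv)`, `Ã = A + (μ − λ)T`, `B̃ = B + (λ − μ)T`.
If `A vᵢ = λᵢ vᵢ` with `λᵢ ≠ μ`, then
`ṽᵢ = vᵢ + ((μ−λ)/(λᵢ−μ))·((uᵀvᵢ)/(uᵀv))·v` satisfies `Ã ṽᵢ = λᵢ ṽᵢ`; similarly, if
`uᵢᵀB = μᵢuᵢᵀ` with `μᵢ ≠ λ`, then
`ũᵢ = uᵢ + ((λ−μ)/(μᵢ−λ))·((uᵢᵀv)/(uᵀv))·u` satisfies `ũᵢᵀB̃ = μᵢũᵢᵀ`. -/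
theorem eigenvectors_of_exchanged_factors
    (m : ℕ) (A B : Matrix (Fin m) (Fin m) ℂ) (lam mu : ℂ)
    (v u : Fin m → ℂ) (hv : v ≠ 0) (hu : u ≠ 0)
    (hAv : A.mulVec v = lam • v)
    (huB : Matrix.vecMul u B = mu • u)
    (huv : u ⬝ᵥ v ≠ 0)
    (T At Bt : Matrix (Fin m) (Fin m) ℂ)
    (hT : T = (u ⬝ᵥ v)⁻¹ • Matrix.vecMulVec v u)
    (hAt : At = A + (mu - lam) • T)
    (hBt : Bt = B + (lam - mu) • T) :
    (∀ (vi : Fin m → ℂ) (lami : ℂ), A.mulVec vi = lami • vi → lami ≠ mu →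
      At.mulVec (vi + (((mu - lam) / (lami - mu)) * ((u ⬝ᵥ vi) / (u ⬝ᵥ v))) • v)
        = lami • (vi + (((mu - lam) / (lami - mu)) * ((u ⬝ᵥ vi) / (u ⬝ᵥ v))) • v)) ∧
    (∀ (ui : Fin m → ℂ) (mui : ℂ), Matrix.vecMul ui B = mui • ui → mui ≠ lam →
      Matrix.vecMul (ui + (((lam - mu) / (mui - lam)) * ((ui ⬝ᵥ v) / (u ⬝ᵥ v))) • u) Bt
        = mui • (ui + (((lam - mu) / (mui - lam)) * ((ui ⬝ᵥ v) / (u ⬝ᵥ v))) • u)) := by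
  subst hAt hBt hT
  constructor
  · intro vi lami h hne
    have hne' : lami - mu ≠ 0 := sub_ne_zero.mpr hne
    have key : ∀ w, ((u ⬝ᵥ v)⁻¹ • Matrix.vecMulVec v u).mulVec w
        = ((u ⬝ᵥ w) / (u ⬝ᵥ v)) • v := by
      intro w
      rw [Matrix.smul_mulVec, Matrix.vecMulVec_mulVec]
      ext i
      simp
      ring
    rw [Matrix.add_mulVec, Matrix.smul_mulVec, key, Matrix.mulVec_add, Matrix.mulVec_smul,
      h, hAv, dotProduct_add, dotProduct_smul]
    ext i
    simp only [Pi.add_apply, Pi.smul_apply, smul_eq_mul]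
    field_simp
    ring
  · intro ui mui h hne
    have hne' : mui - lam ≠ 0 := sub_ne_zero.mpr hne
    have key : ∀ w, Matrix.vecMul w ((u ⬝ᵥ v)⁻¹ • Matrix.vecMulVec v u)
        = ((w ⬝ᵥ v) / (u ⬝ᵥ v)) • u := by
      intro w
      rw [Matrix.vecMul_smul, Matrix.vecMul_vecMulVec]
      ext i
      simp
      ring
    rw [Matrix.vecMul_add, Matrix.vecMul_smul, key, Matrix.add_vecMul, Matrix.smul_vecMul,
      h, huB, add_dotProduct, smul_dotProduct]
    ext i
    simp only [Pi.add_apply, Pi.smul_apply, smul_eq_mul]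
    field_simp
    ring
end

section
/- Fix a positive integer m. On the commutative polynomial ring R = ℂ[t_{ij}^{(r)} : 1 ≤ i, j ≤ m, r ≥ 1] in countably many variables t_{ij}^{(r)}, there exists a unique ℂ-bilinear, antisymmetric bracket {·,·} : R × R → R that is a derivation in each argument and satisfies, on generators, {t_{ij}^{(r)}, t_{kl}^{(s)}} = Σ_{q = max(r,s)}^{r+s−1} ( t_{kj}^{(r+s−q−1)} t_{il}^{(q)} − t_{kj}^{(q)} t_{il}^{(r+s−q−1)} ) for all indices i, j, k, l ∈ {1, …, m} and r, s ≥ 1, where by convention t_{ij}^{(0)} denotes the Kronecker delta δ_{ij} ∈ ℂ. Moreover, this bracket satisfies the Jacobi identity, so {·,·} is a Poisson bracket on R. -/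
open MvPolynomial

/-- The generators `t_{ij}^{(r)}` of the polynomial ring
`R = ℂ[t_{ij}^{(r)} : 1 ≤ i,j ≤ m, r ≥ 1]`: for `r ≥ 1` the variable `t_{ij}^{(r)}`,
and for `r = 0` the Kronecker delta `δ_{ij}` (a scalar). -/
noncomputable def tgen (m : ℕ) (i j : Fin m) (r : ℕ) :
    MvPolynomial (Fin m × Fin m × {r : ℕ // 0 < r}) ℂ :=
  if h : 0 < r then MvPolynomial.X (i, j, ⟨r, h⟩) else if i = j then 1 else 0

/-- A ℂ-bilinear bracket on `R` which is antisymmetric, a derivation in each argument,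
and takes the prescribed Yangian values on the generators `t_{ij}^{(r)}`. -/
def IsYangianBracket (m : ℕ)
    (br : MvPolynomial (Fin m × Fin m × {r : ℕ // 0 < r}) ℂ →ₗ[ℂ]
      MvPolynomial (Fin m × Fin m × {r : ℕ // 0 < r}) ℂ →ₗ[ℂ]
        MvPolynomial (Fin m × Fin m × {r : ℕ // 0 < r}) ℂ) : Prop :=
  (∀ f g, br f g = - br g f) ∧
  (∀ f g h, br (f * g) h = f * br g h + br f h * g) ∧
  (∀ f g h, br f (g * h) = g * br f h + br f g * h) ∧
  (∀ (i j k l : Fin m) (r s : ℕ), 0 < r → 0 < s →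
    br (tgen m i j r) (tgen m k l s) =
      ∑ q ∈ Finset.Icc (max r s) (r + s - 1),
        (tgen m k j (r + s - q - 1) * tgen m i l q
          - tgen m k j q * tgen m i l (r + s - q - 1)))

theorem yv_vanish {σ : Type*} (L : MvPolynomial σ ℂ → MvPolynomial σ ℂ)
    (hadd : ∀ f g, L (f + g) = L f + L g) (hsmul : ∀ (c : ℂ) f, L (c • f) = c • L f)
    (hmul : ∀ f g, L (f * g) = f * L g + L f * g) (hX : ∀ x, L (X x) = 0) (f) : L f = 0 := by
  have h1 : L 1 = 0 := by
    have := hmul 1 1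
    simpa using this
  induction f using MvPolynomial.induction_on with
  | C a => 
    have : (C a : MvPolynomial σ ℂ) = a • 1 := by rw [MvPolynomial.smul_eq_C_mul, mul_one]
    rw [this, hsmul, h1, smul_zero]
  | add p q hp hq => rw [hadd, hp, hq, add_zero]
  | mul_X p x hp => rw [hmul, hp, hX]; simp

theorem yv_vanish2 {σ : Type*} (L : MvPolynomial σ ℂ → MvPolynomial σ ℂ → MvPolynomial σ ℂ)
    (hadd : ∀ f g h, L (f + g) h = L f h + L g h) (hsmul : ∀ (c : ℂ) f h, L (c • f) h = c • L f h)
    (hmul : ∀ f g h, L (f * g) h = f * L g h + L f h * g)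
    (hadd' : ∀ h f g, L h (f + g) = L h f + L h g) (hsmul' : ∀ (c : ℂ) h f, L h (c • f) = c • L h f)
    (hmul' : ∀ h f g, L h (f * g) = f * L h g + L h f * g)
    (hX : ∀ x y, L (X x) (X y) = 0) (f g) : L f g = 0 := 
  yv_vanish (fun f => L f g) (fun _ _ => hadd _ _ _) (fun _ _ => hsmul _ _ _)
    (fun _ _ => hmul _ _ _) (fun x => yv_vanish (L (X x)) (hadd' _) (fun c => hsmul' c _)
      (hmul' _) (hX x) g) f

noncomputable def ysum (m : ℕ) (i j k l : Fin m) (r s : ℕ) :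
    MvPolynomial (Fin m × Fin m × {r : ℕ // 0 < r}) ℂ :=
  ∑ q ∈ Finset.Icc (max r s) (r + s - 1),
        (tgen m k j (r + s - q - 1) * tgen m i l q
          - tgen m k j q * tgen m i l (r + s - q - 1))

theorem ysum_eq (m : ℕ) (i j k l : Fin m) (r s : ℕ) (hr : 0 < r) (hs : 0 < s) :
    ysum m i j k l r s = ∑ a ∈ Finset.range (min r s),
      (tgen m k j a * tgen m i l (r + s - 1 - a) - tgen m k j (r + s - 1 - a) * tgen m i l a) := by
  unfold ysum
  refine Finset.sum_nbij' (fun q => r + s - q - 1) (fun a => r + s - 1 - a) ?_ ?_ ?_ ?_ ?_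
  · intro q hq; simp only [Finset.mem_Icc, Finset.mem_range] at *; omega
  · intro q hq; simp only [Finset.mem_Icc, Finset.mem_range] at *; omega
  · intro q hq; simp only [Finset.mem_Icc] at *; omega
  · intro q hq; simp only [Finset.mem_range] at *; omega
  · intro q hq
    simp only [Finset.mem_Icc] at hq
    have : r + s - 1 - (r + s - q - 1) = q := by omega
    rw [this]

theorem ysum_anti (m : ℕ) (i j k l : Fin m) (r s : ℕ) :
    ysum m i j k l r s = - ysum m k l i j s r := by
  unfold ysum
  rw [← Finset.sum_neg_distrib, max_comm, add_comm r s]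
  exact Finset.sum_congr rfl fun _ _ => by ring

section
variable {m : ℕ}
  {br : MvPolynomial (Fin m × Fin m × {r : ℕ // 0 < r}) ℂ →ₗ[ℂ]
      MvPolynomial (Fin m × Fin m × {r : ℕ // 0 < r}) ℂ →ₗ[ℂ]
        MvPolynomial (Fin m × Fin m × {r : ℕ // 0 < r}) ℂ}

theorem yb_one_left (h : IsYangianBracket m br) (f) : br 1 f = 0 := by
  have := h.2.1 1 1 f
  simpa using this

theorem yb_zero_left (h : IsYangianBracket m br) (i j : Fin m) (f) : br (tgen m i j 0) f = 0 := by
  unfold tgen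
  by_cases hij : i = j <;> simp [hij, yb_one_left h]

theorem yb_zero_right (h : IsYangianBracket m br) (i j : Fin m) (f) : br f (tgen m i j 0) = 0 := by
  rw [h.1, yb_zero_left h, neg_zero]

theorem yb_range (h : IsYangianBracket m br) (i j k l : Fin m) (r s : ℕ) :
    br (tgen m i j r) (tgen m k l s) = ∑ a ∈ Finset.range (min r s),
      (tgen m k j a * tgen m i l (r + s - 1 - a) - tgen m k j (r + s - 1 - a) * tgen m i l a) := by
  rcases Nat.eq_zero_or_pos r with rfl | hr
  · simp [yb_zero_left h]
  rcases Nat.eq_zero_or_pos s with rfl | hs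
  · simp [yb_zero_right h]
  rw [← ysum_eq m i j k l r s hr hs]
  exact h.2.2.2 i j k l r s hr hs

theorem yb_rel_nat (h : IsYangianBracket m br) (i j k l : Fin m) (r s : ℕ) :
    br (tgen m i j (r + 1)) (tgen m k l s) - br (tgen m i j r) (tgen m k l (s + 1)) =
      tgen m k j r * tgen m i l s - tgen m k j s * tgen m i l r := by
  rw [yb_range h, yb_range h]
  have e1 : r + 1 + s - 1 = r + s := by omega
  have e2 : r + (s + 1) - 1 = r + s := by omega
  rw [e1, e2]
  rcases lt_trichotomy r s with hrs | rfl | hrs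
  · have a1 : min (r + 1) s = r + 1 := by omega
    have a2 : min r (s + 1) = r := by omega
    have a3 : r + s - r = s := by omega
    rw [a1, a2, Finset.sum_range_succ, a3]; ring
  · have a1 : min (r + 1) r = r := by omega
    have a2 : min r (r + 1) = r := by omega
    rw [a1, a2]; ring
  · have a1 : min (r + 1) s = s := by omega
    have a2 : min r (s + 1) = s + 1 := by omega
    have a3 : r + s - s = r := by omega
    rw [a1, a2, Finset.sum_range_succ, a3]; ring

noncomputable def yT (m : ℕ) (i j : Fin m) (r : ℤ) :
    MvPolynomial (Fin m × Fin m × {r : ℕ // 0 < r}) ℂ :=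
  if 0 ≤ r then tgen m i j r.toNat else 0

theorem yT_neg (i j : Fin m) (r : ℤ) (hr : r < 0) : yT m i j r = 0 := by
  simp [yT, not_le.2 hr]

theorem yT_nat (i j : Fin m) (r : ℕ) : yT m i j r = tgen m i j r := by
  simp [yT]

theorem yT_zero_left (h : IsYangianBracket m br) (i j : Fin m) (r : ℤ) (hr : r ≤ 0) (f) :
    br (yT m i j r) f = 0 := by
  rcases hr.lt_or_eq with hr | rfl
  · simp [yT_neg i j r hr]
  · simpa [yT] using yb_zero_left h i j f

theorem yT_zero_right (h : IsYangianBracket m br) (i j : Fin m) (r : ℤ) (hr : r ≤ 0) (f) :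
    br f (yT m i j r) = 0 := by
  rw [h.1, yT_zero_left h i j r hr, neg_zero]

theorem yb_rel (h : IsYangianBracket m br) (i j k l : Fin m) (r s : ℤ) :
    br (yT m i j (r + 1)) (yT m k l s) - br (yT m i j r) (yT m k l (s + 1)) =
      yT m k j r * yT m i l s - yT m k j s * yT m i l r := by
  by_cases hr : r < 0
  · rw [yT_zero_left h _ _ (r+1) (by omega), yT_zero_left h _ _ r (by omega),
      yT_neg _ _ r hr, yT_neg _ _ r hr]; simp
  by_cases hs : s < 0
  · rw [yT_zero_right h _ _ (s+1) (by omega), yT_zero_right h _ _ s (by omega),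
      yT_neg _ _ s hs, yT_neg _ _ s hs]; simp
  lift r to ℕ using by omega
  lift s to ℕ using by omega
  have := yb_rel_nat h i j k l r s
  simpa only [← yT_nat, Nat.cast_add, Nat.cast_one] using this

/-- the operator `(u-v)(v-w)(u-w)` -/
def yD {R : Type*} [CommRing R] (G : ℤ → ℤ → ℤ → R) (r s p : ℤ) : R :=
  G (r+2) (s+1) p - G (r+2) s (p+1) - G (r+1) (s+2) p + G (r+1) s (p+2)
    + G r (s+2) (p+1) - G r (s+1) (p+2)

theorem yD_inj {R : Type*} [CommRing R] (G : ℤ → ℤ → ℤ → R)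
    (h1 : ∀ r s p, r ≤ 0 → G r s p = 0) (h2 : ∀ r s p, s ≤ 0 → G r s p = 0)
    (hD : ∀ r s p, yD G r s p = 0) (r s p : ℤ) : G r s p = 0 := by
  have key : ∀ n : ℕ, ∀ r : ℤ, r ≤ n → ∀ s p, G r s p = 0 := by
    intro n
    induction n with
    | zero => intro r hr s p; exact h1 r s p (by simpa using hr)
    | succ n ih =>
      intro r hr
      have key2 : ∀ k : ℕ, ∀ s : ℤ, s ≤ k → ∀ p, G r s p = 0 := by
        intro k
        induction k with
        | zero => intro s hs p; exact h2 r s p (by simpa using hs)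
        | succ k ih2 =>
          intro s hs p
          have := hD (r-2) (s-1) p
          unfold yD at this
          push_cast at hr hs
          rw [ih (r-2+1) (by omega), ih (r-2+1) (by omega), ih (r-2) (by omega),
            ih (r-2) (by omega)] at this
          have e1 : r - 2 + 2 = r := by ring
          have e2 : s - 1 + 1 = s := by ring
          rw [e1, e2, ih2 (s-1) (by omega)] at this
          simpa using this
      intro s p
      exact key2 s.toNat s (by omega) p
  exact key r.toNat r (by omega) s p

theorem yD_triple (h : IsYangianBracket m br) (i j k l a b : Fin m) (r s p : ℤ) :
    yD (fun r s p => br (yT m i j r) (br (yT m k l s) (yT m a b p))) r s p =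
    yT m a l s * (yT m k j (r+1) * yT m i b p - yT m k j p * yT m i b (r+1))
    - yT m a l (s+1) * (yT m k j r * yT m i b p - yT m k j p * yT m i b r)
    + (yT m a j (r+1) * yT m i l s - yT m a j s * yT m i l (r+1)) * yT m k b p
    - (yT m a j r * yT m i l s - yT m a j s * yT m i l r) * yT m k b (p+1)
    - yT m a l p * (yT m k j (r+1) * yT m i b s - yT m k j s * yT m i b (r+1))
    + yT m a l (p+1) * (yT m k j r * yT m i b s - yT m k j s * yT m i b r)
    - (yT m a j (r+1) * yT m i l p - yT m a j p * yT m i l (r+1)) * yT m k b s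
    + (yT m a j r * yT m i l p - yT m a j p * yT m i l r) * yT m k b (s+1) := by
  have L := h.2.2.1
  have rel := fun x i j k l r s => congrArg (br x) (yb_rel h i j k l r s)
  simp only [map_sub, L] at rel
  have r1 := rel (yT m i j (r+2)) k l a b s p
  have r2 := rel (yT m i j (r+1)) k l a b (s+1) p
  have r3 := rel (yT m i j (r+1)) k l a b s (p+1)
  have r4 := rel (yT m i j r) k l a b (s+1) (p+1)
  have c1 := yb_rel h i j k b (r+1) p
  have c2 := yb_rel h i j k b r p
  have c1' := yb_rel h i j k b r (p+1)
  have d1 := yb_rel h i j a l (r+1) s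
  have d2 := yb_rel h i j a l r s
  have e1 := yb_rel h i j k b (r+1) s
  have e2 := yb_rel h i j k b r s
  have f1 := yb_rel h i j a l (r+1) p
  have f2 := yb_rel h i j a l r p
  unfold yD
  simp only [add_assoc, one_add_one_eq_two] at *
  linear_combination r1 - r2 - r3 + r4 + yT m a l s * c1 - yT m a l (s+1) * c2
    + d1 * yT m k b p - d2 * yT m k b (p+1) - yT m a l p * e1 + yT m a l (p+1) * e2
    - f1 * yT m k b s + f2 * yT m k b (s+1)

theorem yJ_gen (h : IsYangianBracket m br) (i j k l a b : Fin m) (r s p : ℤ) :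
    br (yT m i j r) (br (yT m k l s) (yT m a b p)) +
    br (yT m k l s) (br (yT m a b p) (yT m i j r)) +
    br (yT m a b p) (br (yT m i j r) (yT m k l s)) = 0 := by
  refine yD_inj (fun r s p => br (yT m i j r) (br (yT m k l s) (yT m a b p)) +
    br (yT m k l s) (br (yT m a b p) (yT m i j r)) +
    br (yT m a b p) (br (yT m i j r) (yT m k l s))) ?_ ?_ ?_ r s p
  · intro r s p hr
    simp [yT_zero_left h _ _ r hr, yT_zero_right h _ _ r hr]
  · intro r s p hr
    simp [yT_zero_left h _ _ s hr, yT_zero_right h _ _ s hr]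
  · intro r s p
    have h1 := yD_triple h i j k l a b r s p
    have h2 := yD_triple h k l a b i j s p r
    have h3 := yD_triple h a b i j k l p r s
    simp only [yD] at *
    linear_combination h1 + h2 + h3

theorem yX_eq (x : Fin m × Fin m × {r : ℕ // 0 < r}) :
    (X x : MvPolynomial (Fin m × Fin m × {r : ℕ // 0 < r}) ℂ) = tgen m x.1 x.2.1 x.2.2.1 := by
  obtain ⟨i, j, r, hr⟩ := x
  simp [tgen, hr]

theorem yJ (h : IsYangianBracket m br) (f g k) :
    br f (br g k) + br g (br k f) + br k (br f g) = 0 := by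
  obtain ⟨ha, hl, hr, -⟩ := id h
  have step : ∀ g k, (∀ x, br (X x) (br g k) + br g (br k (X x)) + br k (br (X x) g) = 0) →
      ∀ f, br f (br g k) + br g (br k f) + br k (br f g) = 0 := by
    intro g k hX f
    refine yv_vanish (fun f => br f (br g k) + br g (br k f) + br k (br f g)) ?_ ?_ ?_ hX f
    · intro f f'; simp only [map_add, LinearMap.add_apply]; ring
    · intro c f; simp only [map_smul, LinearMap.smul_apply, smul_add]
    · intro f f'
      simp only [map_add, hl, hr]
      rw [ha f' g, ha f g]
      simp only [map_neg]
      ring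
  refine step g k (fun x => ?_) f
  have := step k (X x) (fun y => ?_) g
  · linear_combination this
  have := step (X x) (X y) (fun z => ?_) k
  · linear_combination this
  simp only [yX_eq, ← yT_nat]
  exact yJ_gen h ..

end

noncomputable def yder (m : ℕ) : Derivation ℂ (MvPolynomial (Fin m × Fin m × {r : ℕ // 0 < r}) ℂ)
    (Derivation ℂ (MvPolynomial (Fin m × Fin m × {r : ℕ // 0 < r}) ℂ)
      (MvPolynomial (Fin m × Fin m × {r : ℕ // 0 < r}) ℂ)) :=
  mkDerivation ℂ (fun x => mkDerivation ℂ (fun y =>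
    ysum m x.1 x.2.1 y.1 y.2.1 x.2.2.1 y.2.2.1))

noncomputable def ybr (m : ℕ) : MvPolynomial (Fin m × Fin m × {r : ℕ // 0 < r}) ℂ →ₗ[ℂ]
      MvPolynomial (Fin m × Fin m × {r : ℕ // 0 < r}) ℂ →ₗ[ℂ]
        MvPolynomial (Fin m × Fin m × {r : ℕ // 0 < r}) ℂ :=
  LinearMap.mk₂ ℂ (fun f g => yder m f g) (by intros; simp) (by intros; simp) (by intros; simp)
    (by intros; simp)

theorem ybr_apply (m : ℕ) (f g) : ybr m f g = yder m f g := rfl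

theorem ybr_X (m : ℕ) (x y) : ybr m (X x) (X y) =
    ysum m x.1 x.2.1 y.1 y.2.1 x.2.2.1 y.2.2.1 := by
  rw [ybr_apply, yder, mkDerivation_X, mkDerivation_X]

theorem ybr_l (m : ℕ) (f g h) : ybr m (f * g) h = f * ybr m g h + ybr m f h * g := by
  simp only [ybr_apply, Derivation.leibniz, Derivation.add_apply, Derivation.smul_apply,
    smul_eq_mul]; ring

theorem ybr_r (m : ℕ) (f g h) : ybr m f (g * h) = g * ybr m f h + ybr m f g * h := by
  simp only [ybr_apply, Derivation.leibniz, smul_eq_mul]; ring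

theorem ybr_is (m : ℕ) : IsYangianBracket m (ybr m) := by
  refine ⟨fun f g => ?_, ybr_l m, ybr_r m, ?_⟩
  · rw [eq_neg_iff_add_eq_zero]
    refine yv_vanish2 (fun f g => ybr m f g + ybr m g f) ?_ ?_ ?_ ?_ ?_ ?_ ?_ f g
    · intro f g h; simp only [map_add, LinearMap.add_apply]; ring
    · intro f g h; simp only [map_smul, LinearMap.smul_apply, smul_add]
    · intro f g h; simp only [ybr_l, ybr_r]; ring
    · intro f g h; simp only [map_add, LinearMap.add_apply]; ring
    · intro f g h; simp only [map_smul, LinearMap.smul_apply, smul_add]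
    · intro f g h; simp only [ybr_l, ybr_r]; ring
    · intro x y
      simp only [ybr_X]
      rw [ysum_anti]; ring
  · intro i j k l r s hr hs
    have := ybr_X m (i, j, ⟨r, hr⟩) (k, l, ⟨s, hs⟩)
    simp only [yX_eq] at this
    exact this

theorem yuniq (m : ℕ) (b c) (hb : IsYangianBracket m b) (hc : IsYangianBracket m c) : b = c := by
  refine LinearMap.ext fun f => LinearMap.ext fun g => ?_
  rw [← sub_eq_zero]
  refine yv_vanish2 (fun f g => b f g - c f g) ?_ ?_ ?_ ?_ ?_ ?_ ?_ f g
  · intro f g h; simp only [map_add, LinearMap.add_apply]; ring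
  · intro f g h; simp only [map_smul, LinearMap.smul_apply, smul_sub]
  · intro f g h; simp only [hb.2.1, hc.2.1]; ring
  · intro f g h; simp only [map_add]; ring
  · intro f g h; simp only [map_smul, smul_sub]
  · intro f g h; simp only [hb.2.2.1, hc.2.2.1]; ring
  · intro x y
    simp only [yX_eq]
    rw [hb.2.2.2 _ _ _ _ _ _ x.2.2.2 y.2.2.2, hc.2.2.2 _ _ _ _ _ _ x.2.2.2 y.2.2.2, sub_self]

/-- **The classical Yangian Poisson bracket.** On the polynomial ring
`R = ℂ[t_{ij}^{(r)} : 1 ≤ i,j ≤ m, r ≥ 1]` there exists a unique ℂ-bilinear,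
antisymmetric bracket which is a derivation in each argument and satisfies
`{t_{ij}^{(r)}, t_{kl}^{(s)}} = Σ_{q=max(r,s)}^{r+s−1}
 (t_{kj}^{(r+s−q−1)} t_{il}^{(q)} − t_{kj}^{(q)} t_{il}^{(r+s−q−1)})`
on generators (with `t_{ij}^{(0)} = δ_{ij}`). Moreover, this bracket satisfies the
Jacobi identity, hence is a Poisson bracket on `R`. -/
theorem yangian_poisson_bracket (m : ℕ) :
    (∃! br : MvPolynomial (Fin m × Fin m × {r : ℕ // 0 < r}) ℂ →ₗ[ℂ]
        MvPolynomial (Fin m × Fin m × {r : ℕ // 0 < r}) ℂ →ₗ[ℂ]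
          MvPolynomial (Fin m × Fin m × {r : ℕ // 0 < r}) ℂ,
      IsYangianBracket m br) ∧
    (∀ br, IsYangianBracket m br →
      ∀ f g h, br f (br g h) + br g (br h f) + br h (br f g) = 0) := by
  exact ⟨⟨ybr m, ybr_is m, fun b hb => yuniq m b _ hb (ybr_is m)⟩,
    fun br h f g k => yJ h f g k⟩
end
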